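/- arXiv:1509.04575 — 2 statements merged into one kernel-verified Lean document; each statement's English description precedes it below -/
import Mathlib

section
/- Let X be a set of n ≥ 3 points in general position in the plane and let q ∈ ℝ² \ X be a point such that X ∪ {q} is in general position. Let σ̃_X(q) denote the number of 3-element subsets {x, y, z} of X with q ∈ conv{x, y, z}. Then X contains three pairwise disjoint subsets X₁, X₂, X₃ such that |X₁|·|X₂|·|X₃| ≥ σ̃_X(q)/(16·ln n), and q is contained in conv{x, y, z} for every choice of x ∈ X₁, y ∈ X₂, z ∈ X₃. -/
open scoped Classical

/-- A set of points in the plane is in general position if no three of them are collinear,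
i.e. every three distinct points of it are affinely independent. -/
def InGeneralPosition (S : Set (EuclideanSpace ℝ (Fin 2))) : Prop :=
  ∀ f : Fin 3 → EuclideanSpace ℝ (Fin 2),
    (∀ i, f i ∈ S) → Function.Injective f → AffineIndependent ℝ f

theorem dc_harmonic_sum {α : Type*} (t : α → ℝ) (f : α → ℝ) (K : ℝ) (m : ℕ) :
    ∀ M : Finset α, M.card = m →
      (∀ y ∈ M, f y * ((M.filter fun y' => t y ≤ t y').card : ℝ) ≤ K) →
      (∀ y ∈ M, 0 ≤ f y) →
      ∑ y ∈ M, f y ≤ K * (harmonic m : ℝ) := by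
  induction m with
  | zero =>
    intro M hM _ _
    rw [Finset.card_eq_zero] at hM
    simp [hM]
  | succ m ih =>
    intro M hM h h0
    have hne : M.Nonempty := by
      rw [← Finset.card_pos]; omega
    obtain ⟨y, hy, hmin⟩ := M.exists_min_image t hne
    have h1 := h y hy
    have h2 : (M.filter fun y' => t y ≤ t y') = M := by
      apply Finset.filter_true_of_mem
      exact hmin
    rw [h2, hM] at h1
    have h3 := ih (M.erase y) (by rw [Finset.card_erase_of_mem hy, hM]; rfl)
      (by
        intro z hz
        have hz' := Finset.mem_of_mem_erase hz
        refine le_trans ?_ (h z hz')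
        apply mul_le_mul_of_nonneg_left _ (h0 z hz')
        exact_mod_cast Finset.card_le_card
          (Finset.filter_subset_filter _ (Finset.erase_subset _ _)))
      (fun z hz => h0 z (Finset.mem_of_mem_erase hz))
    rw [← Finset.add_sum_erase M f hy, harmonic_succ]
    have h4 : f y ≤ K * ((m : ℝ) + 1)⁻¹ := by
      rw [← div_eq_mul_inv, le_div_iff₀ (by positivity)]
      push_cast at h1
      exact h1
    push_cast
    linarith

theorem dc_half {α : Type*} (t : α → ℝ) (P M : Finset α) (D : ℝ)
    (hD : (harmonic M.card : ℝ) ≤ D)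
    (hR : ∀ y ∈ M, ∀ y' ∈ M, (P.filter fun z => t y < t z).card ≤
      2 * (P.filter fun z => t y' < t z).card) :
    ∃ A B C : Finset α, A ⊆ P ∧ B ⊆ M ∧ C ⊆ P ∧
      (∀ a ∈ A, ∀ b ∈ B, t a < t b) ∧ (∀ b ∈ B, ∀ c ∈ C, t b < t c) ∧
      ∑ y ∈ M, ((P.filter fun z => t z < t y).card : ℝ) * ((P.filter fun z => t y < t z).card : ℝ)
        ≤ 2 * D * ((A.card : ℝ) * B.card * C.card) := by
  rcases M.eq_empty_or_nonempty with rfl | hne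
  · exact ⟨∅, ∅, ∅, by simp⟩
  obtain ⟨ys, hys, hmax⟩ := M.exists_max_image t hne
  obtain ⟨y0, hy0, hbest⟩ := M.exists_max_image
    (fun y => ((P.filter fun z => t z < t y).card : ℝ) *
      ((M.filter fun y' => t y ≤ t y').card : ℝ)) hne
  refine ⟨P.filter fun z => t z < t y0, M.filter fun y' => t y0 ≤ t y',
    P.filter fun z => t ys < t z, Finset.filter_subset _ _, Finset.filter_subset _ _,
    Finset.filter_subset _ _, ?_, ?_, ?_⟩
  · intro a ha b hb
    exact lt_of_lt_of_le (Finset.mem_filter.1 ha).2 (Finset.mem_filter.1 hb).2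
  · intro b hb c hc
    exact lt_of_le_of_lt (hmax b (Finset.mem_filter.1 hb).1) (Finset.mem_filter.1 hc).2
  · have h1 := dc_harmonic_sum t (fun y => ((P.filter fun z => t z < t y).card : ℝ)) _ _ M rfl
      hbest (fun _ _ => by positivity)
    set K : ℝ := ((P.filter fun z => t z < t y0).card : ℝ) *
      ((M.filter fun y' => t y0 ≤ t y').card : ℝ) with hK
    have hK0 : 0 ≤ K := by positivity
    set r : ℝ := ((P.filter fun z => t ys < t z).card : ℝ) with hr
    have hr0 : 0 ≤ r := by positivity
    calc _ ≤ ∑ y ∈ M, ((P.filter fun z => t z < t y).card : ℝ) * (2 * r) := by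
            apply Finset.sum_le_sum
            intro y hy
            apply mul_le_mul_of_nonneg_left _ (by positivity)
            rw [hr]
            exact_mod_cast hR y hy ys hys
      _ = (∑ y ∈ M, ((P.filter fun z => t z < t y).card : ℝ)) * (2 * r) := by
            rw [Finset.sum_mul]
      _ ≤ (K * D) * (2 * r) := by
            apply mul_le_mul_of_nonneg_right _ (by positivity)
            exact h1.trans (mul_le_mul_of_nonneg_left hD hK0)
      _ = _ := by ring

theorem dc_harmonic_mono {a b : ℕ} (h : a ≤ b) : (harmonic a : ℝ) ≤ harmonic b := by
  have : harmonic a ≤ harmonic b := by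
    unfold harmonic
    apply Finset.sum_le_sum_of_subset_of_nonneg
    · intro i hi
      simp only [Finset.mem_range] at *
      omega
    · intros
      positivity
  exact_mod_cast this

theorem dc_full {α : Type*} (t : α → ℝ) (P N : Finset α) (D : ℝ)
    (hD : (harmonic N.card : ℝ) ≤ D) (hPN : ∀ x ∈ P, ∀ y ∈ N, t x ≠ t y) :
    ∃ A B C : Finset α, A ⊆ P ∧ B ⊆ N ∧ C ⊆ P ∧
      (∀ a ∈ A, ∀ b ∈ B, t a < t b) ∧ (∀ b ∈ B, ∀ c ∈ C, t b < t c) ∧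
      ∑ y ∈ N, ((P.filter fun z => t z < t y).card : ℝ) * ((P.filter fun z => t y < t z).card : ℝ)
        ≤ 4 * D * ((A.card : ℝ) * B.card * C.card) := by
  have hsum : ∀ y ∈ N, (P.filter fun z => t z < t y).card + (P.filter fun z => t y < t z).card
      = P.card := by
    intro y hy
    rw [← Finset.card_filter_add_card_filter_not (s := P) (fun z => t z < t y)]
    congr 2
    apply Finset.filter_congr
    intro z hz
    have := hPN z hz y hy
    rw [not_lt]
    exact ⟨le_of_lt, fun h => lt_of_le_of_ne h this.symm⟩
  let Q : α → Prop := fun y => (P.filter fun z => t z < t y).card ≤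
    (P.filter fun z => t y < t z).card
  obtain ⟨A, B, C, hA, hB, hC, hAB, hBC, h⟩ := dc_half t P (N.filter Q) D
    ((dc_harmonic_mono (Finset.card_filter_le _ _)).trans hD) (by
      intro y hy y' hy'
      rw [Finset.mem_filter] at hy hy'
      have h1 := hsum y hy.1
      have h2 := hsum y' hy'.1
      have h3 := hy'.2
      simp only [Q] at h3
      omega)
  obtain ⟨A', B', C', hA', hB', hC', hAB', hBC', h'⟩ := dc_half (fun x => - t x) P
    (N.filter fun y => ¬ Q y) D
    ((dc_harmonic_mono (Finset.card_filter_le _ _)).trans hD) (by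
      intro y hy y' hy'
      rw [Finset.mem_filter] at hy hy'
      have h1 := hsum y hy.1
      have h2 := hsum y' hy'.1
      have h3 := hy'.2
      simp only [Q] at h3
      simp only [neg_lt_neg_iff]
      omega)
  simp only [neg_lt_neg_iff] at h' hAB' hBC'
  have hs := Finset.sum_filter_add_sum_filter_not N Q (fun y =>
    ((P.filter fun z => t z < t y).card : ℝ) * ((P.filter fun z => t y < t z).card : ℝ))
  have h'' : ∑ y ∈ N.filter (fun y => ¬ Q y), ((P.filter fun z => t z < t y).card : ℝ) *
      ((P.filter fun z => t y < t z).card : ℝ) ≤ 2 * D * ((A'.card : ℝ) * B'.card * C'.card) := by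
    refine le_trans (le_of_eq ?_) h'
    exact Finset.sum_congr rfl fun _ _ => mul_comm _ _
  by_cases hc : 2 * D * ((A.card : ℝ) * B.card * C.card) ≤
      2 * D * ((A'.card : ℝ) * B'.card * C'.card)
  · refine ⟨C', B', A', hC', hB'.trans (Finset.filter_subset _ _), hA',
      fun a ha b hb => hBC' b hb a ha, fun b hb c hc => hAB' c hc b hb, ?_⟩
    rw [← hs]
    linarith
  · refine ⟨A, B, C, hA, hB.trans (Finset.filter_subset _ _), hC, hAB, hBC, ?_⟩
    rw [← hs]
    linarith

/-- number of ordered triples as a sum -/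
theorem dc_count {α : Type*} (t : α → ℝ) (P N : Finset α) :
    (((P ×ˢ N ×ˢ P).filter fun p => t p.1 < t p.2.1 ∧ t p.2.1 < t p.2.2).card : ℝ) =
    ∑ y ∈ N, ((P.filter fun z => t z < t y).card : ℝ) *
      ((P.filter fun z => t y < t z).card : ℝ) := by
  have : ((P ×ˢ N ×ˢ P).filter fun p => t p.1 < t p.2.1 ∧ t p.2.1 < t p.2.2).card =
    ∑ y ∈ N, (P.filter fun z => t z < t y).card * (P.filter fun z => t y < t z).card := by
    rw [Finset.card_eq_sum_card_fiberwise (f := fun p => p.2.1) (t := N)]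
    · apply Finset.sum_congr rfl
      intro y hy
      rw [← Finset.card_product]
      refine Finset.card_bij' (fun p _ => (p.1, p.2.2)) (fun p _ => (p.1, y, p.2)) ?_ ?_ ?_ ?_
      · intro p hp
        simp only [Finset.mem_filter, Finset.mem_product] at hp ⊢
        obtain ⟨⟨⟨h1, h2, h3⟩, h4, h5⟩, rfl⟩ := hp
        exact ⟨⟨h1, h4⟩, h3, h5⟩
      · intro p hp
        simp only [Finset.mem_filter, Finset.mem_product] at hp ⊢
        tauto
      · intro p hp
        simp only [Finset.mem_filter, Finset.mem_product] at hp
        obtain ⟨_, rfl⟩ := hp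
        rfl
      · intro p hp
        rfl
    · intro p hp
      simp only [Finset.coe_filter, Finset.mem_product, Set.mem_ofPred_eq] at hp
      exact hp.1.2.1
  rw [this]
  push_cast
  rfl

theorem dc_sort {α : Type*} (t : α → ℝ) (S : Finset α) (hS : S.card = 3)
    (ht : ∀ x ∈ S, ∀ y ∈ S, t x = t y → x = y) :
    ∃ x y z, (∀ a, a ∈ S ↔ a = x ∨ a = y ∨ a = z) ∧ t x < t y ∧ t y < t z := by
  obtain ⟨x, y, z, hxy, hxz, hyz, rfl⟩ := Finset.card_eq_three.1 hS
  have h1 : t x ≠ t y := fun h => hxy (ht x (by simp) y (by simp) h)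
  have h2 : t x ≠ t z := fun h => hxz (ht x (by simp) z (by simp) h)
  have h3 : t y ≠ t z := fun h => hyz (ht y (by simp) z (by simp) h)
  rcases lt_or_gt_of_ne h1 with h1 | h1 <;> rcases lt_or_gt_of_ne h2 with h2 | h2 <;>
    rcases lt_or_gt_of_ne h3 with h3 | h3
  · exact ⟨x, y, z, by intro a; simp, h1, h3⟩
  · exact ⟨x, z, y, by intro a; simp; tauto, h2, h3⟩
  · exact absurd (h1.trans h3) (not_lt.2 h2.le)
  · exact ⟨z, x, y, by intro a; simp; tauto, h2, h1⟩
  · exact ⟨y, x, z, by intro a; simp; tauto, h1, h2⟩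
  · exact absurd (h1.trans h2) (not_lt.2 h3.le)
  · exact ⟨y, z, x, by intro a; simp; tauto, h3, h2⟩
  · exact ⟨z, y, x, by intro a; simp; tauto, h3, h1⟩

theorem dc_mem_hull {E : Type*} [AddCommGroup E] [Module ℝ E] (x y z q : E) (a b c : ℝ)
    (ha : 0 ≤ a) (hb : 0 ≤ b) (hc : 0 ≤ c) (habc : a + b + c = 1)
    (h : a • x + b • y + c • z = q) : q ∈ convexHull ℝ ({x, y, z} : Set E) := by
  have hconv := convex_convexHull ℝ ({x, y, z} : Set E)
  have := hconv.sum_mem (t := (Finset.univ : Finset (Fin 3))) (w := ![a, b, c])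
    (z := ![x, y, z]) (by intro i _; fin_cases i <;> simpa)
    (by simp [Fin.sum_univ_three, habc])
    (by intro i _; fin_cases i <;> exact subset_convexHull _ _ (by simp))
  simpa [Fin.sum_univ_three, h] using this

theorem dc_of_mem_hull {E : Type*} [AddCommGroup E] [Module ℝ E] (x y z q : E)
    (h : q ∈ convexHull ℝ ({x, y, z} : Set E)) :
    ∃ a b c : ℝ, 0 ≤ a ∧ 0 ≤ b ∧ 0 ≤ c ∧ a + b + c = 1 ∧ a • x + b • y + c • z = q := by
  rw [convexHull_insert (by simp), convexHull_pair] at h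
  simp only [convexJoin_singleton_left, Set.mem_iUnion] at h
  obtain ⟨p, ⟨b, c, hb, hc, hbc, rfl⟩, ⟨d, e, hd, he, hde, rfl⟩⟩ := h
  refine ⟨d, e * b, e * c, hd, by positivity, by positivity, ?_, ?_⟩
  · rw [add_assoc, ← mul_add, hbc, mul_one, hde]
  · simp only [smul_add, mul_smul, add_assoc]

/-- sufficient condition in coordinates -/
theorem dc_geom (w1 w2 w3 t1 t2 t3 : ℝ) (h12 : t1 < t2) (h23 : t2 < t3)
    (hw12 : w1 * w2 < 0) (hw23 : w2 * w3 < 0) :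
    ∃ a b c : ℝ, 0 ≤ a ∧ 0 ≤ b ∧ 0 ≤ c ∧ a + b + c = 1 ∧
      a * w1 + b * w2 + c * w3 = 0 ∧ a * (w1 * t1) + b * (w2 * t2) + c * (w3 * t3) = 0 := by
  have key : ∀ u1 u2 u3 : ℝ, 0 < u1 → u2 < 0 → 0 < u3 →
    ∃ a b c : ℝ, 0 ≤ a ∧ 0 ≤ b ∧ 0 ≤ c ∧ a + b + c = 1 ∧
      a * u1 + b * u2 + c * u3 = 0 ∧
      a * (u1 * t1) + b * (u2 * t2) + c * (u3 * t3) = 0 := by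
    intro u1 u2 u3 h1 h2 h3
    have ha : 0 < (t3 - t2) / u1 := div_pos (by linarith) h1
    have hb : 0 < (t3 - t1) / (-u2) := div_pos (by linarith) (by linarith)
    have hc : 0 < (t2 - t1) / u3 := div_pos (by linarith) h3
    have e1 : (t3 - t2) / u1 * u1 = t3 - t2 := div_mul_cancel₀ _ h1.ne'
    have e2 : (t3 - t1) / (-u2) * u2 = -(t3 - t1) := by
      have : u2 ≠ 0 := h2.ne
      field_simp
    have e3 : (t2 - t1) / u3 * u3 = t2 - t1 := div_mul_cancel₀ _ h3.ne'
    generalize (t3 - t2) / u1 = a at *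
    generalize (t3 - t1) / (-u2) = b at *
    generalize (t2 - t1) / u3 = c at *
    have hs : 0 < a + b + c := by positivity
    refine ⟨a / (a + b + c), b / (a + b + c), c / (a + b + c), by positivity, by positivity,
      by positivity, by field_simp, ?_, ?_⟩
    · have : a / (a + b + c) * u1 + b / (a + b + c) * u2 + c / (a + b + c) * u3 =
        (a * u1 + b * u2 + c * u3) / (a + b + c) := by ring
      rw [this, e1, e2, e3]
      ring
    · have : a / (a + b + c) * (u1 * t1) + b / (a + b + c) * (u2 * t2) +
          c / (a + b + c) * (u3 * t3) =
        ((a * u1) * t1 + (b * u2) * t2 + (c * u3) * t3) / (a + b + c) := by ring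
      rw [this, e1, e2, e3]
      ring
  rcases lt_trichotomy w2 0 with h | h | h
  · exact key w1 w2 w3 (by nlinarith) h (by nlinarith)
  · simp [h] at hw12
  · obtain ⟨a, b, c, ha, hb, hc, hs, e1, e2⟩ :=
      key (-w1) (-w2) (-w3) (by nlinarith) (by linarith) (by nlinarith)
    exact ⟨a, b, c, ha, hb, hc, hs, by linarith, by linarith⟩

theorem dc_geom_conv (w1 w2 w3 t1 t2 t3 a b c : ℝ) (h12 : t1 < t2) (h23 : t2 < t3)
    (hw1 : w1 ≠ 0) (hw2 : w2 ≠ 0) (hw3 : w3 ≠ 0) (ha : 0 ≤ a) (hb : 0 ≤ b) (hc : 0 ≤ c)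
    (hs : a + b + c = 1) (e1 : a * w1 + b * w2 + c * w3 = 0)
    (e2 : a * (w1 * t1) + b * (w2 * t2) + c * (w3 * t3) = 0) :
    w1 * w2 < 0 ∧ w2 * w3 < 0 := by
  have f1 : (b * w2) * (t2 - t1) + (c * w3) * (t3 - t1) = 0 := by linear_combination e2 - t1 * e1
  have f2 : (a * w1) * (t3 - t1) + (b * w2) * (t3 - t2) = 0 := by linear_combination t3 * e1 - e2
  have hb0 : b ≠ 0 := by
    rintro rfl
    have hc0 : c = 0 := by
      have : c * w3 * (t3 - t1) = 0 := by linarith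
      simpa [hw3, (sub_pos.2 (h12.trans h23)).ne'] using this
    have ha0 : a = 0 := by
      have : a * w1 * (t3 - t1) = 0 := by linarith
      simpa [hw1, (sub_pos.2 (h12.trans h23)).ne'] using this
    subst hc0 ha0
    norm_num at hs
  have hbp : 0 < b := lt_of_le_of_ne hb hb0.symm
  have g13 : 0 < t3 - t1 := by linarith
  have g12 : 0 < t2 - t1 := by linarith
  have g23 : 0 < t3 - t2 := by linarith
  have hw2sq : 0 < w2 * w2 := mul_self_pos.2 hw2
  constructor
  · have : (w1 * w2) * (a * (t3 - t1)) = -(b * (w2 * w2) * (t3 - t2)) := by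
      linear_combination w2 * f2
    by_contra hcon
    push Not at hcon
    have h1 : 0 ≤ (w1 * w2) * (a * (t3 - t1)) := by positivity
    have h2 : 0 < b * (w2 * w2) * (t3 - t2) := by positivity
    linarith
  · have : (w2 * w3) * (c * (t3 - t1)) = -(b * (w2 * w2) * (t2 - t1)) := by
      linear_combination w2 * f1
    by_contra hcon
    push Not at hcon
    have h1 : 0 ≤ (w2 * w3) * (c * (t3 - t1)) := by positivity
    have h2 : 0 < b * (w2 * w2) * (t2 - t1) := by positivity
    linarith

theorem dc_inj3 {α : Type*} (x y z : α) (h1 : x ≠ y) (h2 : x ≠ z) (h3 : y ≠ z) :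
    Function.Injective ![x, y, z] := by
  intro i j hij
  fin_cases i <;> fin_cases j <;> simp [h1, h2, h3, h1.symm, h2.symm, h3.symm] at hij ⊢

theorem dc_arith (a b L p p' : ℝ) (h1 : a ≤ 4 * (2 * L) * p) (h2 : b ≤ 4 * (2 * L) * p')
    (hc : 4 * (2 * L) * p ≤ 4 * (2 * L) * p') : a + b ≤ p' * (16 * L) := by
  linarith

theorem dc_arith' (a b L p p' : ℝ) (h1 : a ≤ 4 * (2 * L) * p) (h2 : b ≤ 4 * (2 * L) * p')
    (hc : 4 * (2 * L) * p' ≤ 4 * (2 * L) * p) : a + b ≤ p * (16 * L) := by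
  linarith

set_option maxHeartbeats 8000000 in
/-- **Depth Carathéodory theorem in the plane** (Theorem 5 of the paper):
if `σ̃_X(q)` denotes the number of 3-element subsets of `X` whose convex hull contains `q`,
then there are pairwise disjoint subsets `X₁, X₂, X₃ ⊆ X` with
`|X₁|·|X₂|·|X₃| ≥ σ̃_X(q)/(16·ln n)` such that every triangle with one vertex in each `Xᵢ`
contains `q`. -/
theorem depth_caratheodory_plane (X : Finset (EuclideanSpace ℝ (Fin 2))) (hn : 3 ≤ X.card)
    (q : EuclideanSpace ℝ (Fin 2)) (hqX : q ∉ X)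
    (hgen : InGeneralPosition ((X : Set (EuclideanSpace ℝ (Fin 2))) ∪ {q})) :
    ∃ X₁ X₂ X₃ : Finset (EuclideanSpace ℝ (Fin 2)),
      X₁ ⊆ X ∧ X₂ ⊆ X ∧ X₃ ⊆ X ∧
      Disjoint X₁ X₂ ∧ Disjoint X₁ X₃ ∧ Disjoint X₂ X₃ ∧
      (((X.powersetCard 3).filter fun S =>
            q ∈ convexHull ℝ (S : Set (EuclideanSpace ℝ (Fin 2)))).card : ℝ) /
          (16 * Real.log X.card) ≤
        (X₁.card : ℝ) * (X₂.card : ℝ) * (X₃.card : ℝ) ∧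
      ∀ x ∈ X₁, ∀ y ∈ X₂, ∀ z ∈ X₃,
        q ∈ convexHull ℝ ({x, y, z} : Set (EuclideanSpace ℝ (Fin 2))) := by
  set n := X.card with hn'
  obtain ⟨k, hk⟩ := Infinite.exists_notMem_finset
    (X.image fun x => -(x 0 - q 0) / (x 1 - q 1))
  let w : EuclideanSpace ℝ (Fin 2) → ℝ := fun x => (x 0 - q 0) + k * (x 1 - q 1)
  let t : EuclideanSpace ℝ (Fin 2) → ℝ := fun x => (x 1 - q 1) / w x
  have hw : ∀ x ∈ X, w x ≠ 0 := by
    intro x hx h0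
    by_cases h1 : x 1 - q 1 = 0
    · have h2 : x 0 - q 0 = 0 := by simpa [w, h1] using h0
      apply hqX
      have : x = q := by
        ext i
        fin_cases i
        · simpa [sub_eq_zero] using h2
        · simpa [sub_eq_zero] using h1
      rwa [← this]
    · apply hk
      rw [Finset.mem_image]
      refine ⟨x, hx, ?_⟩
      rw [div_eq_iff h1]
      simp only [w] at h0
      linarith
  have hwt : ∀ x ∈ X, w x * t x = x 1 - q 1 := by
    intro x hx
    exact mul_div_cancel₀ _ (hw x hx)
  have hinj : ∀ x ∈ X, ∀ y ∈ X, t x = t y → x = y := by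
    intro x hx y hy hxy
    by_contra hne
    have hxq : x ≠ q := fun h => hqX (h ▸ hx)
    have hyq : y ≠ q := fun h => hqX (h ▸ hy)
    have hai := hgen ![x, y, q] (by intro i; fin_cases i <;> simp [hx, hy]) (by
      exact dc_inj3 x y q hne hxq hyq)
    rw [affineIndependent_iff_not_collinear_set] at hai
    apply hai
    rw [collinear_iff_of_mem (p₀ := q) (by simp)]
    refine ⟨x - q, ?_⟩
    intro p hp
    have hp' : p = x ∨ p = y ∨ p = q := by simpa using hp
    have hx1 := hwt x hx
    have hy1 := hwt y hy
    have hwx := hw x hx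
    rcases hp' with rfl | rfl | rfl
    · exact ⟨1, by simp⟩
    · refine ⟨w p / w x, ?_⟩
      have e1 : p 1 - q 1 = w p / w x * (x 1 - q 1) := by
        rw [← hx1, ← hy1, hxy]; field_simp
      have e0 : p 0 - q 0 = w p / w x * (x 0 - q 0) := by
        have a1 : p 0 - q 0 = w p - k * (p 1 - q 1) := by simp only [w]; ring
        have a2 : x 0 - q 0 = w x - k * (x 1 - q 1) := by simp only [w]; ring
        rw [a1, a2, e1]; field_simp
      ext i
      fin_cases i
      · simp; linarith
      · simp; linarith
    · exact ⟨0, by simp⟩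
  have hsuff : ∀ x ∈ X, ∀ y ∈ X, ∀ z ∈ X, t x < t y → t y < t z → w x * w y < 0 →
      w y * w z < 0 → q ∈ convexHull ℝ ({x, y, z} : Set (EuclideanSpace ℝ (Fin 2))) := by
    intro x hx y hy z hz h1 h2 h3 h4
    obtain ⟨a, b, c, ha, hb, hc, hs, e1, e2⟩ := dc_geom _ _ _ _ _ _ h1 h2 h3 h4
    refine dc_mem_hull x y z q a b c ha hb hc hs ?_
    rw [hwt x hx, hwt y hy, hwt z hz] at e2
    have e3 : a * (x 0 - q 0) + b * (y 0 - q 0) + c * (z 0 - q 0) = 0 := by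
      simp only [w] at e1
      linear_combination e1 - k * e2
    ext i
    fin_cases i
    · simp; linear_combination e3 + q 0 * hs
    · simp; linear_combination e2 + q 1 * hs
  have hnec : ∀ x ∈ X, ∀ y ∈ X, ∀ z ∈ X, t x < t y → t y < t z →
      q ∈ convexHull ℝ ({x, y, z} : Set (EuclideanSpace ℝ (Fin 2))) →
      w x * w y < 0 ∧ w y * w z < 0 := by
    intro x hx y hy z hz h1 h2 h3
    obtain ⟨a, b, c, ha, hb, hc, hs, e⟩ := dc_of_mem_hull x y z q h3
    have e0 : a * x 0 + b * y 0 + c * z 0 = q 0 := by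
      rw [← e]; simp
    have e1 : a * x 1 + b * y 1 + c * z 1 = q 1 := by
      have := congrArg (fun v => v 1) e
      simpa using this
    apply dc_geom_conv _ _ _ _ _ _ a b c h1 h2 (hw x hx) (hw y hy) (hw z hz) ha hb hc hs
    · simp only [w]
      linear_combination e0 + k * e1 - (q 0 + k * q 1) * hs
    · rw [hwt x hx, hwt y hy, hwt z hz]
      linear_combination e1 - q 1 * hs
  let P := X.filter fun x => 0 < w x
  let N := X.filter fun x => w x < 0
  have hPX : P ⊆ X := Finset.filter_subset _ _
  have hNX : N ⊆ X := Finset.filter_subset _ _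
  have hPw : ∀ x ∈ P, 0 < w x := fun x hx => (Finset.mem_filter.1 hx).2
  have hNw : ∀ x ∈ N, w x < 0 := fun x hx => (Finset.mem_filter.1 hx).2
  have hPN : ∀ x ∈ P, ∀ y ∈ N, t x ≠ t y := by
    intro x hx y hy h
    have := hinj x (hPX hx) y (hNX hy) h
    subst this
    linarith [hPw x hx, hNw x hy]
  have hlog1 : 1 ≤ Real.log n := by
    rw [Real.le_log_iff_exp_le (by positivity)]
    have : (3 : ℝ) ≤ n := by exact_mod_cast hn
    linarith [Real.exp_one_lt_d9]
  have hpos : 0 < 16 * Real.log n := by linarith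
  have hpos8 : 0 ≤ 4 * (2 * Real.log n) := by linarith
  have hharm : (harmonic n : ℝ) ≤ 2 * Real.log n := by
    linarith [harmonic_le_one_add_log n]
  obtain ⟨A, B, C, hA, hB, hC, hAB, hBC, h1⟩ := dc_full t P N (2 * Real.log n)
    ((dc_harmonic_mono (Finset.card_le_card hNX)).trans hharm) hPN
  obtain ⟨A', B', C', hA', hB', hC', hAB', hBC', h2⟩ := dc_full t N P (2 * Real.log n)
    ((dc_harmonic_mono (Finset.card_le_card hPX)).trans hharm)
    (fun x hx y hy => (hPN y hy x hx).symm)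
  rw [← dc_count] at h1 h2
  set T1 := (P ×ˢ N ×ˢ P).filter fun p => t p.1 < t p.2.1 ∧ t p.2.1 < t p.2.2 with hT1
  set T2 := (N ×ˢ P ×ˢ N).filter fun p => t p.1 < t p.2.1 ∧ t p.2.1 < t p.2.2 with hT2
  have hcount : ((X.powersetCard 3).filter fun S =>
      q ∈ convexHull ℝ (S : Set (EuclideanSpace ℝ (Fin 2)))).card ≤ T1.card + T2.card := by
    refine le_trans (Finset.card_le_card (t := (T1 ∪ T2).image fun p => {p.1, p.2.1, p.2.2}) ?_)
      (Finset.card_image_le.trans (Finset.card_union_le _ _))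
    intro S hS
    rw [Finset.mem_filter] at hS
    obtain ⟨hS, hq⟩ := hS
    simp only [Finset.bind_def, Finset.mem_sup, Finset.pure_def, Finset.mem_singleton] at hS
    obtain ⟨S, hS, rfl⟩ := hS
    rw [Finset.mem_powersetCard] at hS
    obtain ⟨hSX, hS3⟩ := hS
    obtain ⟨x, y, z, hmem, hxy, hyz⟩ := dc_sort t S hS3
      (fun x hx y hy => hinj x (hSX hx) y (hSX hy))
    have hx : x ∈ X := hSX ((hmem x).2 (Or.inl rfl))
    have hy : y ∈ X := hSX ((hmem y).2 (Or.inr (Or.inl rfl)))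
    have hz : z ∈ X := hSX ((hmem z).2 (Or.inr (Or.inr rfl)))
    have hSe : (S : Set (EuclideanSpace ℝ (Fin 2))) = {x, y, z} := by
      ext a
      exact hmem a
    rw [hSe] at hq ⊢
    obtain ⟨g1, g2⟩ := hnec x hx y hy z hz hxy hyz hq
    rw [Finset.mem_image]
    refine ⟨(x, y, z), ?_, rfl⟩
    simp only [hT1, hT2, P, N, Finset.mem_union, Finset.mem_filter, Finset.mem_product]
    rcases lt_or_gt_of_ne (hw y hy) with h | h
    · left
      exact ⟨⟨⟨hx, by nlinarith⟩, ⟨hy, h⟩, hz, by nlinarith⟩, hxy, hyz⟩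
    · right
      exact ⟨⟨⟨hx, by nlinarith⟩, ⟨hy, h⟩, hz, by nlinarith⟩, hxy, hyz⟩
  have hcount' : (((X.powersetCard 3).filter fun S =>
      q ∈ convexHull ℝ (S : Set (EuclideanSpace ℝ (Fin 2)))).card : ℝ) ≤ T1.card + T2.card :=
    (Nat.cast_le.2 hcount).trans (Nat.cast_add _ _).le
  clear hcount
  clear_value T1 T2
  have hdisj : ∀ A B : Finset (EuclideanSpace ℝ (Fin 2)), (∀ a ∈ A, ∀ b ∈ B, t a < t b) →
      Disjoint A B := by
    intro A B h
    rw [Finset.disjoint_left]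
    intro a ha hb
    exact lt_irrefl _ (h a ha a hb)
  have hdisj2 : ∀ A B C : Finset (EuclideanSpace ℝ (Fin 2)), B.Nonempty →
      (∀ a ∈ A, ∀ b ∈ B, t a < t b) → (∀ b ∈ B, ∀ c ∈ C, t b < t c) →
      Disjoint A C := by
    intro A B C ⟨b, hb⟩ h h'
    exact hdisj A C fun a ha c hc => (h a ha b hb).trans (h' b hb c hc)
  by_cases hc : 4 * (2 * Real.log n) * ((A.card : ℝ) * B.card * C.card) ≤
      4 * (2 * Real.log n) * ((A'.card : ℝ) * B'.card * C'.card)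
  · rcases B'.eq_empty_or_nonempty with hBe | hBn
    · refine ⟨∅, ∅, ∅, by simp, by simp, by simp, by simp, by simp, by simp, ?_, by simp⟩
      refine le_trans (div_le_div_of_nonneg_right hcount' hpos.le) ?_
      rw [div_le_iff₀ hpos]
      have hz : (A'.card : ℝ) * B'.card * C'.card = 0 := by
        rw [hBe, Finset.card_empty, Nat.cast_zero, mul_zero, zero_mul]
      rw [hz, mul_zero] at h2 hc
      rw [Finset.card_empty, Nat.cast_zero, mul_zero, zero_mul]
      exact (add_le_add (h1.trans hc) h2).trans (add_zero 0).le
    · refine ⟨A', B', C', hA'.trans hNX, hB'.trans hPX, hC'.trans hNX, hdisj _ _ hAB',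
        hdisj2 _ _ _ hBn hAB' hBC', hdisj _ _ hBC', ?_, ?_⟩
      · refine le_trans (div_le_div_of_nonneg_right hcount' hpos.le) ?_
        rw [div_le_iff₀ hpos]
        exact dc_arith _ _ _ _ _ h1 h2 hc
      · intro x hx y hy z hz
        have k1 := hNw x (hA' hx)
        have k2 := hPw y (hB' hy)
        have k3 := hNw z (hC' hz)
        exact hsuff x (hNX (hA' hx)) y (hPX (hB' hy)) z (hNX (hC' hz)) (hAB' x hx y hy)
          (hBC' y hy z hz) (mul_neg_of_neg_of_pos k1 k2) (mul_neg_of_pos_of_neg k2 k3)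
  · rcases B.eq_empty_or_nonempty with hBe | hBn
    · exfalso
      apply hc
      rw [hBe, Finset.card_empty, Nat.cast_zero, mul_zero, zero_mul, mul_zero]
      exact mul_nonneg hpos8 (mul_nonneg (mul_nonneg (Nat.cast_nonneg _) (Nat.cast_nonneg _))
        (Nat.cast_nonneg _))
    · refine ⟨A, B, C, hA.trans hPX, hB.trans hNX, hC.trans hPX, hdisj _ _ hAB,
        hdisj2 _ _ _ hBn hAB hBC, hdisj _ _ hBC, ?_, ?_⟩
      · refine le_trans (div_le_div_of_nonneg_right hcount' hpos.le) ?_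
        rw [div_le_iff₀ hpos]
        exact dc_arith' _ _ _ _ _ h1 h2 (le_of_not_ge hc)
      · intro x hx y hy z hz
        have k1 := hPw x (hA hx)
        have k2 := hNw y (hB hy)
        have k3 := hPw z (hC hz)
        exact hsuff x (hPX (hA hx)) y (hNX (hB hy)) z (hPX (hC hz)) (hAB x hx y hy)
          (hBC y hy z hz) (mul_neg_of_pos_of_neg k1 k2) (mul_neg_of_neg_of_pos k2 k3)
end

section
/- For every dimension d ≥ 1 and every real β with 0 ≤ β < 1 there exists α > 0 such that the following holds for every n ≥ d+1. Let C_1, …, C_n be convex sets in ℝ^d. Suppose that for every choice of index sets I_1, …, I_{d+1} ⊆ {1, …, n}, each of size at least αn, there exist indices i_1 ∈ I_1, …, i_{d+1} ∈ I_{d+1} with C_{i_1} ∩ ⋯ ∩ C_{i_{d+1}} ≠ ∅. Then there exists an index set J ⊆ {1, …, n} with |J| ≥ βn such that ⋂_{j ∈ J} C_j ≠ ∅. -/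
/-- Euclidean space of dimension `d`. -/
abbrev Eu (d : ℕ) : Type := EuclideanSpace ℝ (Fin d)

lemma det_interp {d : ℕ} (s : Fin (d + 1) → ℝ) (hs : Function.Injective s)
    (A : EuclideanSpace ℝ (Fin d) →L[ℝ] EuclideanSpace ℝ (Fin d)) :
    ∑ j, (Lagrange.basis Finset.univ s j).eval 1 *
      (ContinuousLinearMap.id ℝ _ + s j • A).det =
      (ContinuousLinearMap.id ℝ _ + A).det := by
  classical
  let b := (EuclideanSpace.basisFun (Fin d) ℝ).toBasis
  let M := LinearMap.toMatrix b b (A : EuclideanSpace ℝ (Fin d) →ₗ[ℝ] EuclideanSpace ℝ (Fin d))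
  let P : Polynomial ℝ := Matrix.det ((Polynomial.X : Polynomial ℝ) • M.map Polynomial.C
    + (1 : Matrix (Fin d) (Fin d) ℝ).map Polynomial.C)
  have hP : ∀ t : ℝ, P.eval t = (ContinuousLinearMap.id ℝ _ + t • A).det := by
    intro t
    have h1 : P.eval t = (t • M + 1).det := by
      have : P.eval t = Polynomial.evalRingHom t P := rfl
      rw [this, RingHom.map_det]
      congr 1
      ext i j
      by_cases hij : i = j
      · subst hij; simp [Matrix.map_apply]; ring
      · simp [Matrix.map_apply, Matrix.one_apply_ne hij]; ring
    rw [h1, ContinuousLinearMap.det, ← LinearMap.det_toMatrix b]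
    congr 1
    simp only [M, ContinuousLinearMap.toLinearMap_add, ContinuousLinearMap.toLinearMap_smul,
      map_add, map_smul]
    rw [add_comm, show ((ContinuousLinearMap.id ℝ (EuclideanSpace ℝ (Fin d)) : EuclideanSpace ℝ (Fin d) →L[ℝ] EuclideanSpace ℝ (Fin d)) : EuclideanSpace ℝ (Fin d) →ₗ[ℝ] EuclideanSpace ℝ (Fin d)) = LinearMap.id from rfl, LinearMap.toMatrix_id]
  have hdeg : P.degree < (Finset.univ : Finset (Fin (d + 1))).card := by
    have h := Polynomial.natDegree_det_X_add_C_le M 1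
    have : P.degree ≤ (d : ℕ) := by
      refine Polynomial.natDegree_le_iff_degree_le.1 ?_
      rw [Fintype.card_fin] at h
      exact h
    refine lt_of_le_of_lt this ?_
    simp only [Finset.card_univ, Fintype.card_fin]
    exact_mod_cast Nat.lt_succ_self d
  have h := Lagrange.eq_interpolate (v := s) (s := Finset.univ) hs.injOn hdeg
  have h2 := congrArg (Polynomial.eval 1) h
  rw [Lagrange.interpolate_apply, Polynomial.eval_finsetSum, hP, one_smul] at h2
  rw [h2]
  refine Finset.sum_congr rfl fun j _ => ?_
  rw [Polynomial.eval_mul, Polynomial.eval_C, hP, mul_comm]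

lemma sum_basis_eval {d : ℕ} (s : Fin (d + 1) → ℝ) (hs : Function.Injective s) :
    ∑ j, (Lagrange.basis Finset.univ s j).eval 1 = 1 := by
  have h := Lagrange.sum_basis (v := s) (s := Finset.univ) hs.injOn Finset.univ_nonempty
  have h2 := congrArg (Polynomial.eval 1) h
  rw [Polynomial.eval_finsetSum] at h2
  simpa using h2

section
open MeasureTheory Metric Set Topology

lemma small_det_pos {d : ℕ} (A : EuclideanSpace ℝ (Fin d) →L[ℝ] EuclideanSpace ℝ (Fin d))
    (t K : ℝ) (ht : 0 ≤ t) (hA : ‖A‖ ≤ K) (htK : t * K < 1) :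
    0 < (ContinuousLinearMap.id ℝ _ + t • A).det := by
  by_contra hneg
  push Not at hneg
  have hc : Continuous fun r : ℝ => (ContinuousLinearMap.id ℝ (EuclideanSpace ℝ (Fin d)) + r • A).det := by
    have := ContinuousLinearMap.continuous_det (𝕜 := ℝ) (E := EuclideanSpace ℝ (Fin d))
    exact this.comp (by fun_prop)
  have h0 : (ContinuousLinearMap.id ℝ (EuclideanSpace ℝ (Fin d)) + (0:ℝ) • A).det = 1 := by
    simp [ContinuousLinearMap.det]
  obtain ⟨r, hr, hr0⟩ := intermediate_value_Icc' ht hc.continuousOn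
    (show (0:ℝ) ∈ Icc _ _ from ⟨hneg, by rw [h0]; norm_num⟩)
  simp only [ContinuousLinearMap.det] at hr0
  have hb := LinearMap.bot_lt_ker_of_det_eq_zero hr0
  obtain ⟨v, hv, hv0⟩ := (Submodule.ne_bot_iff _).1 hb.ne'
  have hv' : v + r • A v = 0 := by simpa using hv
  have h1 : ‖v‖ = ‖r • A v‖ := by
    conv_lhs => rw [eq_neg_of_add_eq_zero_left hv', norm_neg]
  have hvp : 0 < ‖v‖ := norm_pos_iff.2 hv0
  have h2 : ‖r • A v‖ ≤ r * (K * ‖v‖) := by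
    rw [norm_smul, Real.norm_of_nonneg hr.1]
    exact mul_le_mul_of_nonneg_left ((A.le_opNorm v).trans (by gcongr)) hr.1
  have hK : 0 ≤ K := (norm_nonneg A).trans hA
  have h3 : r * (K * ‖v‖) ≤ t * K * ‖v‖ := by
    rw [← mul_assoc]; gcongr; exact hr.2
  nlinarith

lemma det_zero_of_range {d : ℕ} {f : Eu d →ₗ[ℝ] Eu d} (h : f.range ≠ ⊤) : f.det = 0 := by
  by_contra hne
  have := (LinearMap.isUnit_iff_range_eq_top f).1 ((LinearMap.isUnit_iff_isUnit_det f).2 (isUnit_iff_ne_zero.2 hne))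
  exact h this

lemma no_retraction {d : ℕ} (ρ : ℝ) (hρ : 0 < ρ)
    (f : Eu d → Eu d) (hf : ContDiff ℝ 1 f)
    (h1 : ∀ x, ‖x‖ = ρ → f x = x) (h2 : ∀ x, ‖f x‖ = ρ) : False := by
  classical
  let g : Eu d → Eu d := fun x => f x - x
  have hg : ContDiff ℝ 1 g := hf.sub contDiff_id
  have hgd : Differentiable ℝ g := hg.differentiable one_ne_zero
  have hg' : Continuous (fderiv ℝ g) := hg.continuous_fderiv one_ne_zero
  obtain ⟨K0, hK0⟩ := (isCompact_closedBall (0 : Eu d) ρ).exists_bound_of_continuousOn hg'.continuousOn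
  let K : ℝ := max K0 0
  have hK : ∀ x ∈ closedBall (0 : Eu d) ρ, ‖fderiv ℝ g x‖ ≤ K :=
    fun x hx => (hK0 x hx).trans (le_max_left _ _)
  have hKn : 0 ≤ K := le_max_right _ _
  have hlip : ∀ x ∈ closedBall (0 : Eu d) ρ, ∀ y ∈ closedBall (0 : Eu d) ρ,
      ‖g x - g y‖ ≤ K * ‖x - y‖ := fun x hx y hy =>
    (convex_closedBall (0 : Eu d) ρ).norm_image_sub_le_of_norm_fderiv_le
      (fun z _ => hgd z) hK hy hx
  -- main volume claim
  have hvol : ∀ t : ℝ, 0 < t → t < 1 → t * K < 1 →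
      ∫ x in ball (0 : Eu d) ρ, (ContinuousLinearMap.id ℝ (Eu d) + t • fderiv ℝ g x).det
        = (volume (ball (0 : Eu d) ρ)).toReal := by
    intro t ht ht1 htK
    let F : Eu d → Eu d := fun x => x + t • g x
    have hF : ∀ x, HasStrictFDerivAt F (ContinuousLinearMap.id ℝ (Eu d) + t • fderiv ℝ g x) x := by
      intro x
      exact (hasStrictFDerivAt_id x).add
        (((hg.contDiffAt).hasStrictFDerivAt one_ne_zero).const_smul t)
    have hpos : ∀ x ∈ closedBall (0 : Eu d) ρ,
        0 < (ContinuousLinearMap.id ℝ (Eu d) + t • fderiv ℝ g x).det :=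
      fun x hx => small_det_pos _ t K ht.le (hK x hx) htK
    have hinj : InjOn F (ball 0 ρ) := by
      intro x hx y hy hxy
      have e : x - y = t • (g y - g x) := by
        have : x + t • g x = y + t • g y := hxy
        rw [smul_sub, sub_eq_sub_iff_add_eq_add, this, add_comm]
      by_contra hne
      have hp : 0 < ‖x - y‖ := norm_pos_iff.2 (sub_ne_zero.2 hne)
      have l := hlip y (ball_subset_closedBall hy) x (ball_subset_closedBall hx)
      have : ‖x - y‖ ≤ t * (K * ‖x - y‖) := by
        calc ‖x - y‖ = t * ‖g y - g x‖ := by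
              conv_lhs => rw [e]
              rw [norm_smul, Real.norm_of_nonneg ht.le]
          _ ≤ _ := by rw [norm_sub_rev x y]; gcongr
      nlinarith
    have hFn : ∀ x, ‖F x‖ ≤ (1 - t) * ‖x‖ + t * ρ := by
      intro x
      have : F x = (1 - t) • x + t • f x := by
        simp only [F, g, smul_sub, sub_smul, one_smul]; abel
      rw [this]
      refine (norm_add_le _ _).trans ?_
      rw [norm_smul, norm_smul, h2, Real.norm_of_nonneg ht.le,
        Real.norm_of_nonneg (by linarith)]
    have hmaps : F '' ball 0 ρ ⊆ ball 0 ρ := by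
      rintro _ ⟨x, hx, rfl⟩
      rw [mem_ball_zero_iff] at hx ⊢
      have := hFn x
      nlinarith
    have hopen : IsOpen (F '' ball 0 ρ) := by
      rw [isOpen_iff_mem_nhds]
      rintro _ ⟨x, hx, rfl⟩
      have hsurj : (ContinuousLinearMap.id ℝ (Eu d) + t • fderiv ℝ g x).range = ⊤ := by
        have hu := (hpos x (ball_subset_closedBall hx)).ne'
        by_contra hne
        exact hu (det_zero_of_range (f := ((ContinuousLinearMap.id ℝ (Eu d) + t • fderiv ℝ g x : Eu d →L[ℝ] Eu d) : Eu d →ₗ[ℝ] Eu d)) hne)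
      rw [← (hF x).map_nhds_eq_of_surj hsurj]
      exact Filter.image_mem_map (isOpen_ball.mem_nhds hx)
    have hFc : Continuous F := continuous_id.add (hg.continuous.const_smul t)
    have himg : F '' ball 0 ρ = ball 0 ρ := by
      refine Subset.antisymm hmaps ?_
      have hpc : IsPreconnected (ball (0 : Eu d) ρ) := (convex_ball (0 : Eu d) ρ).isPreconnected
      refine hpc.subset_of_closure_inter_subset hopen ?_ ?_
      · refine ⟨F 0, hmaps ⟨0, mem_ball_self hρ, rfl⟩, ⟨0, mem_ball_self hρ, rfl⟩⟩
      · rintro y ⟨hy, hyb⟩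
        have hcl : IsClosed (F '' closedBall 0 ρ) :=
          ((isCompact_closedBall (0 : Eu d) ρ).image hFc).isClosed
        obtain ⟨x, hx, rfl⟩ := closure_minimal (image_mono ball_subset_closedBall) hcl hy
        rcases (mem_closedBall_zero_iff.1 hx).lt_or_eq with h | h
        · exact ⟨x, mem_ball_zero_iff.2 h, rfl⟩
        · exfalso
          have : F x = x := by simp [F, g, h1 x h]
          rw [this, mem_ball_zero_iff] at hyb
          linarith
    have hcv := integral_image_eq_integral_abs_det_fderiv_smul (volume : Measure (Eu d))
      (s := ball (0 : Eu d) ρ) measurableSet_ball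
      (fun x _ => (hF x).hasFDerivAt.hasFDerivWithinAt) hinj (fun _ => (1 : ℝ))
    rw [himg] at hcv
    simp only [smul_eq_mul, mul_one, integral_const, MeasurableSet.univ, measureReal_restrict_apply,
      univ_inter] at hcv
    rw [Measure.real] at hcv
    rw [hcv]
    refine setIntegral_congr_fun measurableSet_ball fun x hx => ?_
    exact (abs_of_pos (hpos x (ball_subset_closedBall hx))).symm
  let τ : ℝ := 1 / (K + 2)
  have hτ : 0 < τ := by positivity
  let s : Fin (d + 1) → ℝ := fun j => τ / ((j : ℕ) + 1 : ℝ)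
  have hs : Function.Injective s := by
    intro i j hij
    simp only [s] at hij
    have hi : ((i : ℕ) + 1 : ℝ) ≠ 0 := by positivity
    have hj : ((j : ℕ) + 1 : ℝ) ≠ 0 := by positivity
    rw [div_eq_div_iff hi hj] at hij
    have := mul_left_cancel₀ hτ.ne' hij
    have h3 : ((i : ℕ) : ℝ) = (j : ℕ) := by linarith
    exact Fin.ext (by exact_mod_cast h3)
  have hs0 : ∀ j, 0 < s j := fun j => by positivity
  have hsτ : ∀ j, s j ≤ τ := fun j => by
    refine div_le_self hτ.le ?_
    have : (0:ℝ) ≤ (j : ℕ) := by positivity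
    linarith
  have hτK : τ * (K + 2) = 1 := by simp only [τ]; field_simp
  have hz : ∀ x, (ContinuousLinearMap.id ℝ (Eu d) + fderiv ℝ g x).det = 0 := by
    intro x
    have e : ContinuousLinearMap.id ℝ (Eu d) + fderiv ℝ g x = fderiv ℝ f x := by
      have : fderiv ℝ g x = fderiv ℝ f x - ContinuousLinearMap.id ℝ (Eu d) := by
        have := fderiv_fun_sub (𝕜 := ℝ) (f := f) (g := fun x => x) (x := x)
          (hf.differentiable one_ne_zero x) differentiableAt_id
        rw [fderiv_fun_id] at this
        exact this
      rw [this]; abel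
    rw [e]
    by_contra hne
    have hsurj : Function.Surjective (fderiv ℝ f x) := by
      refine LinearMap.range_eq_top (f := (fderiv ℝ f x : Eu d →ₗ[ℝ] Eu d)) |>.1 ?_
      by_contra hr
      exact hne (det_zero_of_range hr)
    obtain ⟨v, hv⟩ := hsurj (f x)
    have hd := ((hf.differentiable one_ne_zero x).hasFDerivAt).inner ℝ
      ((hf.differentiable one_ne_zero x).hasFDerivAt)
    have hconst : (fun t => inner ℝ (f t) (f t)) = fun _ : Eu d => ρ ^ 2 := by
      funext t; rw [real_inner_self_eq_norm_sq, h2]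
    rw [hconst] at hd
    have := hd.unique (hasFDerivAt_const _ _)
    have h3 := congrArg (fun L => L v) this
    simp [hv, real_inner_self_eq_norm_sq, h2] at h3
    exact hρ.ne' h3
  have hint : ∀ t : ℝ, IntegrableOn (fun x => (ContinuousLinearMap.id ℝ (Eu d) + t • fderiv ℝ g x).det)
      (ball (0 : Eu d) ρ) := by
    intro t
    have hc : Continuous fun x => (ContinuousLinearMap.id ℝ (Eu d) + t • fderiv ℝ g x).det :=
      ContinuousLinearMap.continuous_det.comp (continuous_const.add (hg'.const_smul t))
    exact (hc.continuousOn.integrableOn_compact (isCompact_closedBall (0 : Eu d) ρ)).mono_set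
      ball_subset_closedBall
  have key : ∫ x in ball (0 : Eu d) ρ, ∑ j, (Lagrange.basis Finset.univ s j).eval 1 *
      (ContinuousLinearMap.id ℝ (Eu d) + s j • fderiv ℝ g x).det = 0 := by
    have : ∀ x, ∑ j, (Lagrange.basis Finset.univ s j).eval 1 *
      (ContinuousLinearMap.id ℝ (Eu d) + s j • fderiv ℝ g x).det = 0 :=
      fun x => (det_interp s hs _).trans (hz x)
    simp_rw [this]
    simp
  rw [integral_finsetSum _ (fun j _ => (hint (s j)).const_mul _)] at key
  simp_rw [integral_const_mul] at key
  have hv : ∀ j, ∫ x in ball (0 : Eu d) ρ, (ContinuousLinearMap.id ℝ (Eu d) + s j • fderiv ℝ g x).det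
        = (volume (ball (0 : Eu d) ρ)).toReal := fun j =>
    hvol _ (hs0 j) (by have := hsτ j; nlinarith) (by have := hsτ j; nlinarith)
  simp_rw [hv] at key
  rw [← Finset.sum_mul, sum_basis_eval s hs, one_mul] at key
  have : 0 < (volume (ball (0 : Eu d) ρ)).toReal :=
    ENNReal.toReal_pos (measure_ball_pos _ _ hρ).ne' measure_ball_lt_top.ne
  linarith
end


section
open Metric Set Topology

lemma no_field {d : ℕ} (ρ : ℝ) (hρ : 0 < ρ) (f : Eu d → Eu d) (hf : ContDiff ℝ 1 f)
    (h0 : ∀ x, f x ≠ 0) (hb : ∀ x, ‖x‖ = ρ → f x = x) : False := by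
  refine no_retraction ρ hρ (fun x => (ρ / ‖f x‖) • f x) ?_ ?_ ?_
  · exact (contDiff_const.div (hf.norm ℝ h0) (fun x => norm_ne_zero_iff.2 (h0 x))).smul hf
  · intro x hx
    simp only [hb x hx, hx]
    rw [div_self hρ.ne', one_smul]
  · intro x
    have := norm_pos_iff.2 (h0 x)
    rw [norm_smul, Real.norm_of_nonneg (by positivity)]
    field_simp

open Classical in
lemma hull_zero {d : ℕ} {τ : Type} [Fintype τ] (V : τ → Eu d) :
    (0 : Eu d) ∉ convexHull ℝ {w : Eu d |
      (d + 1) * (Finset.univ.filter fun t => inner ℝ (V t) w ≤ 0).card < Fintype.card τ} := by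
  intro h
  obtain ⟨ι, hι, z, c, hz, haff, hc, hc1, hsum⟩ := eq_pos_convex_span_of_mem_convexHull h
  have hcard : Fintype.card ι ≤ d + 1 := by
    have h1 := haff.card_le_finrank_succ
    have h2 := Submodule.finrank_le (vectorSpan ℝ (Set.range z))
    simp only [finrank_euclideanSpace, Fintype.card_fin] at h2
    omega
  have hne : Nonempty ι := by
    by_contra hemp
    rw [not_nonempty_iff] at hemp
    simp at hc1
  let B : ι → Finset τ := fun i => Finset.univ.filter fun t => inner ℝ (V t) (z i) ≤ 0
  have hB : ∀ i, (d + 1) * (B i).card < Fintype.card τ := fun i => hz ⟨i, rfl⟩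
  have hex : ∃ t, ∀ i, t ∉ B i := by
    by_contra hcon
    push Not at hcon
    have hu : (Finset.univ : Finset τ) ⊆ Finset.univ.biUnion B := by
      intro t _
      obtain ⟨i, hi⟩ := hcon t
      exact Finset.mem_biUnion.2 ⟨i, Finset.mem_univ _, hi⟩
    have h1 : Fintype.card τ ≤ ∑ i, (B i).card :=
      (Finset.card_le_card hu).trans Finset.card_biUnion_le
    have h2 : ∑ i, (d + 1) * (B i).card < ∑ _i : ι, Fintype.card τ :=
      Finset.sum_lt_sum_of_nonempty Finset.univ_nonempty fun i _ => hB i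
    rw [← Finset.mul_sum, Finset.sum_const, Finset.card_univ, smul_eq_mul] at h2
    have h3 : (d + 1) * Fintype.card τ ≤ (d + 1) * ∑ i, (B i).card := Nat.mul_le_mul_left _ h1
    have h4 := Nat.mul_le_mul_right (Fintype.card τ) hcard
    omega
  obtain ⟨t, ht⟩ := hex
  have hp : ∀ i, 0 < inner ℝ (V t) (z i) := fun i => by
    have := ht i
    simpa [B] using this
  have h1 : inner ℝ (V t) (∑ i, c i • z i) = ∑ i, c i * inner ℝ (V t) (z i) := by
    rw [inner_sum]; simp [inner_smul_right]
  rw [hsum, inner_zero_right] at h1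
  have : 0 < ∑ i, c i * inner ℝ (V t) (z i) :=
    Finset.sum_pos (fun i _ => mul_pos (hc i) (hp i)) Finset.univ_nonempty
  linarith

open Classical in
lemma deep_field {d : ℕ} {τ : Type} [Fintype τ] (V : τ → Eu d → Eu d) (hV : ∀ t, Continuous (V t))
    (R : ℝ) (hR : 0 < R)
    (hfar : ∀ p, R ≤ ‖p‖ → (d + 1) * (Finset.univ.filter fun t => inner ℝ (V t p) (-p) ≤ 0).card
      < Fintype.card τ) :
    ∃ p, ∀ w, Fintype.card τ ≤ (d + 1) * (Finset.univ.filter fun t => inner ℝ (V t p) w ≤ 0).card := by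
  by_contra hcon
  push Not at hcon
  let W : Eu d → Set (Eu d) := fun p => {w : Eu d |
      (d + 1) * (Finset.univ.filter fun t => inner ℝ (V t p) w ≤ 0).card < Fintype.card τ}
  let S : Eu d → Set (Eu d) := fun p => if ‖p‖ < R + 1 then convexHull ℝ (W p) else {-p}
  have hconv : ∀ p, Convex ℝ (S p) := by
    intro p
    simp only [S]
    split_ifs
    · exact convex_convexHull _ _
    · exact convex_singleton _
  have hloc : ∀ p : Eu d, ∃ U ∈ 𝓝 p, ∃ g : Eu d → Eu d,
      ContMDiffOn (modelWithCornersSelf ℝ (Eu d)) (modelWithCornersSelf ℝ (Eu d)) 1 g U ∧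
      ∀ y ∈ U, g y ∈ S y := by
    intro p
    by_cases hp : ‖p‖ < R + 1
    · obtain ⟨w, hw⟩ := hcon p
      have hev : ∀ᶠ y in 𝓝 p, ‖y‖ < R + 1 ∧
          ∀ t, 0 < inner ℝ (V t p) w → 0 < inner ℝ (V t y) w := by
        refine Filter.Eventually.and ?_ ?_
        · exact continuous_norm.continuousAt.eventually (gt_mem_nhds hp)
        · rw [Filter.eventually_all]
          intro t
          by_cases h : 0 < inner ℝ (V t p) w
          · have hc : Continuous fun y => inner ℝ (V t y) w := (hV t).inner continuous_const
            filter_upwards [hc.continuousAt.eventually (lt_mem_nhds h)] with y hy _ using hy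
          · exact Filter.Eventually.of_forall fun y h' => absurd h' h
      refine ⟨_, hev, fun _ => w, contMDiffOn_const, ?_⟩
      rintro y ⟨hy1, hy2⟩
      simp only [S, if_pos hy1]
      refine subset_convexHull ℝ _ ?_
      refine lt_of_le_of_lt (Nat.mul_le_mul_left _ (Finset.card_le_card ?_)) hw
      intro t
      simp only [Finset.mem_filter, Finset.mem_univ, true_and]
      intro ht
      by_contra hlt
      push Not at hlt
      exact absurd (hy2 t hlt) (not_lt.2 ht)
    · have hp' : R < ‖p‖ := by linarith
      refine ⟨{y | R < ‖y‖}, (isOpen_lt continuous_const continuous_norm).mem_nhds hp',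
        fun y => -y, ?_, ?_⟩
      · exact (contDiff_neg.contMDiff).contMDiffOn
      · intro y hy
        simp only [S]
        split_ifs
        · exact subset_convexHull ℝ _ (hfar y (le_of_lt hy))
        · rfl
  obtain ⟨g, hg⟩ := exists_contMDiffMap_forall_mem_convex_of_local
    (modelWithCornersSelf ℝ (Eu d)) (n := 1) hconv hloc
  have hgs : ContDiff ℝ 1 (fun x => - g x) := (g.contMDiff.contDiff).neg
  refine no_field (R + 1) (by linarith) _ hgs ?_ ?_
  · intro x hx
    have h0 : g x = 0 := neg_eq_zero.1 hx
    have := hg x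
    simp only [S] at this
    split_ifs at this with h
    · rw [h0] at this
      exact hull_zero (fun t => V t x) this
    · rw [h0] at this
      have h3 : (0 : Eu d) = -x := this
      have : x = 0 := by rw [← neg_neg x, ← h3, neg_zero]
      rw [this, norm_zero] at h
      linarith
  · intro x hx
    have := hg x
    simp only [S] at this
    rw [if_neg (by linarith)] at this
    have h3 : g x = -x := this
    rw [h3, neg_neg]
end

open Classical in
lemma deep_point (d : ℕ) (β : ℝ) (hβ0 : 0 ≤ β) (hβ1 : β < 1) :
    ∃ γ : ℝ, 0 < γ ∧ ∀ n : ℕ, 0 < n → ∀ v : Fin n → Eu d → Eu d, (∀ i, Continuous (v i)) →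
      ∀ R : ℝ, 0 < R → (∀ i p, R ≤ ‖p‖ → v i p = 0 ∨ 0 < inner ℝ (v i p) (-p)) →
      (∀ p, ((Finset.univ.filter fun i => v i p = 0).card : ℝ) ≤ β * n) →
      ∃ p, ∀ w, γ * n ≤ ((Finset.univ.filter fun i => v i p ≠ 0 ∧ inner ℝ (v i p) w ≤ 0).card : ℝ) := by
  obtain ⟨k, hk⟩ := exists_pow_lt_of_lt_one (show (0:ℝ) < 1 / (2 * (d + 1)) by positivity) hβ1
  have hk0 : k ≠ 0 := by
    rintro rfl
    rw [pow_zero, lt_div_iff₀ (by positivity)] at hk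
    have : (0:ℝ) ≤ d := by positivity
    linarith
  have hkp : (0:ℝ) < k := by exact_mod_cast Nat.pos_of_ne_zero hk0
  refine ⟨1 / (2 * (d + 1) * k), by positivity, ?_⟩
  intro n hn v hv R hR hfar hz
  have hnp : (0:ℝ) < n := by exact_mod_cast hn
  let V : (Fin k → Fin n) → Eu d → Eu d := fun T p => ∑ j, v (T j) p
  have hV : ∀ T, Continuous (V T) := fun T => continuous_finsetSum _ fun j _ => hv _
  let Z : Eu d → Finset (Fin n) := fun p => Finset.univ.filter fun i => v i p = 0
  have hZ : ∀ p, ((Fintype.piFinset fun _ : Fin k => Z p).card : ℝ) ≤ β ^ k * n ^ k := by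
    intro p
    rw [Fintype.card_piFinset]
    simp only [Finset.prod_const, Finset.card_univ, Fintype.card_fin, Nat.cast_pow]
    rw [← mul_pow]
    exact pow_le_pow_left₀ (by positivity) (hz p) k
  have hZ2 : β ^ k * n ^ k * (2 * (d + 1)) < (n : ℝ) ^ k := by
    rw [lt_div_iff₀ (by positivity)] at hk
    have : (0:ℝ) < (n:ℝ) ^ k := by positivity
    nlinarith
  have hcardT : Fintype.card (Fin k → Fin n) = n ^ k := by simp
  obtain ⟨p, hp⟩ := deep_field V hV R hR (by
    intro p hpR
    rw [hcardT]
    have hsub : (Finset.univ.filter fun T => inner ℝ (V T p) (-p) ≤ 0) ⊆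
        Fintype.piFinset fun _ : Fin k => Z p := by
      intro T hT
      simp only [Finset.mem_filter, Finset.mem_univ, true_and] at hT
      rw [Fintype.mem_piFinset]
      have hsum : inner ℝ (V T p) (-p) = ∑ j, inner ℝ (v (T j) p) (-p) := by
        simp only [V]; rw [sum_inner]
      have hnn : ∀ j, 0 ≤ inner ℝ (v (T j) p) (-p) := fun j => by
        rcases hfar (T j) p hpR with h | h
        · rw [h, inner_zero_left]
        · exact h.le
      intro j
      simp only [Z, Finset.mem_filter, Finset.mem_univ, true_and]
      rcases hfar (T j) p hpR with h | h
      · exact h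
      · exfalso
        have := Finset.single_le_sum (f := fun j => inner ℝ (v (T j) p) (-p))
          (fun j _ => hnn j) (Finset.mem_univ j)
        rw [hsum] at hT
        linarith
    have h1 : ((Finset.univ.filter fun T => inner ℝ (V T p) (-p) ≤ 0).card : ℝ) ≤ β ^ k * n ^ k :=
      le_trans (by exact_mod_cast Finset.card_le_card hsub) (hZ p)
    have h2 : (((d + 1) * (Finset.univ.filter fun T => inner ℝ (V T p) (-p) ≤ 0).card : ℕ) : ℝ)
        < ((n ^ k : ℕ) : ℝ) := by
      push_cast
      have h3 : (0:ℝ) < d + 1 := by positivity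
      have h4 : (0:ℝ) ≤ β ^ k * n ^ k := by positivity
      nlinarith
    exact_mod_cast h2)
  refine ⟨p, fun w => ?_⟩
  have hpw := hp w
  rw [hcardT] at hpw
  set D : Finset (Fin n) := Finset.univ.filter fun i => v i p ≠ 0 ∧ inner ℝ (v i p) w ≤ 0 with hD
  let Q : Fin k → Finset (Fin k → Fin n) := fun j =>
    Fintype.piFinset fun j' => if j' = j then D else Finset.univ
  have hQ : ∀ j, (Q j).card = D.card * n ^ (k - 1) := by
    intro j
    simp only [Q]
    rw [Fintype.card_piFinset, ← Finset.mul_prod_erase Finset.univ _ (Finset.mem_univ j), if_pos rfl]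
    congr 1
    rw [Finset.prod_congr rfl (g := fun _ => n)]
    · simp
    · intro x hx
      rw [if_neg (Finset.ne_of_mem_erase hx)]; simp
  have hsub : (Finset.univ.filter fun T => inner ℝ (V T p) w ≤ 0) ⊆
      (Fintype.piFinset fun _ : Fin k => Z p) ∪ Finset.univ.biUnion Q := by
    intro T hT
    simp only [Finset.mem_filter, Finset.mem_univ, true_and] at hT
    rw [Finset.mem_union]
    by_contra hcon
    push Not at hcon
    obtain ⟨h1, h2⟩ := hcon
    have hnD : ∀ j, T j ∉ D := by
      intro j hj
      apply h2
      rw [Finset.mem_biUnion]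
      refine ⟨j, Finset.mem_univ _, ?_⟩
      simp only [Q, Fintype.mem_piFinset]
      intro a
      split_ifs with h
      · rw [h]; exact hj
      · exact Finset.mem_univ _
    have hcase : ∀ j, v (T j) p = 0 ∨ 0 < inner ℝ (v (T j) p) w := by
      intro j
      have := hnD j
      simp only [hD, Finset.mem_filter, Finset.mem_univ, true_and, not_and, not_le] at this
      by_cases h : v (T j) p = 0
      · exact Or.inl h
      · exact Or.inr (this h)
    have hsum : inner ℝ (V T p) w = ∑ j, inner ℝ (v (T j) p) w := by
      simp only [V]; rw [sum_inner]
    have hnn : ∀ j, 0 ≤ inner ℝ (v (T j) p) w := fun j => by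
      rcases hcase j with h | h
      · rw [h, inner_zero_left]
      · exact h.le
    apply h1
    rw [Fintype.mem_piFinset]
    intro j
    simp only [Z, Finset.mem_filter, Finset.mem_univ, true_and]
    rcases hcase j with h | h
    · exact h
    · exfalso
      have := Finset.single_le_sum (f := fun j => inner ℝ (v (T j) p) w)
        (fun j _ => hnn j) (Finset.mem_univ j)
      rw [hsum] at hT
      linarith
  have hc1 : ((Finset.univ.filter fun T => inner ℝ (V T p) w ≤ 0).card : ℝ) ≤
      β ^ k * n ^ k + k * (D.card * n ^ (k - 1)) := by
    have h1 := Finset.card_le_card hsub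
    have h2 := h1.trans (Finset.card_union_le _ _)
    have h3 : (Finset.univ.biUnion Q).card ≤ k * (D.card * n ^ (k - 1)) := by
      refine Finset.card_biUnion_le.trans ?_
      simp [hQ]
    have h4 : ((Finset.univ.filter fun T => inner ℝ (V T p) w ≤ 0).card : ℝ) ≤
        ((Fintype.piFinset fun _ : Fin k => Z p).card : ℝ) + ((k * (D.card * n ^ (k - 1)) : ℕ) : ℝ) := by
      exact_mod_cast h2.trans (Nat.add_le_add_left h3 _)
    push_cast at h4
    linarith [hZ p]
  have hc2 : (n : ℝ) ^ k ≤ (d + 1) * ((Finset.univ.filter fun T => inner ℝ (V T p) w ≤ 0).card : ℝ) := by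
    exact_mod_cast hpw
  have hnk : (n : ℝ) ^ k = n * n ^ (k - 1) := by
    rw [← pow_succ']; congr 1; omega
  have hpos : (0:ℝ) < (n:ℝ) ^ (k - 1) := by positivity
  have hd : (0:ℝ) < d + 1 := by positivity
  have h5 : (n : ℝ) ^ k ≤ (d + 1) * (β ^ k * n ^ k + k * (D.card * n ^ (k - 1))) :=
    hc2.trans (by gcongr)
  have h6 : (n : ℝ) ^ k ≤ 2 * (d + 1) * k * D.card * n ^ (k - 1) := by nlinarith
  rw [hnk] at h6
  have h7 : (n : ℝ) ≤ 2 * (d + 1) * k * D.card := le_of_mul_le_mul_right h6 hpos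
  rw [one_div, inv_mul_le_iff₀ (by positivity)]
  exact h7


/-- centerpoint -/
theorem centerpoint (d : ℕ) {κ : Type*} (u : κ → Eu d) (X : Finset κ) (hX : X.Nonempty) :
    ∃ o : Eu d, ∀ w : Eu d,
      X.card ≤ (d + 1) * (X.filter (fun x => inner ℝ o w ≤ inner ℝ (u x) w)).card := by
  classical
  set F : Finset (Finset κ) := X.powerset.filter (fun Z => d * X.card < (d + 1) * Z.card) with hF
  have hXF : X ∈ F := by
    simp only [hF, Finset.mem_filter, Finset.mem_powerset, subset_refl, true_and]
    have := hX.card_pos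
    nlinarith
  have key : (⋂ Z ∈ F, convexHull ℝ (u '' (Z : Set κ))).Nonempty := by
    apply Convex.helly_theorem' (𝕜 := ℝ)
    · intro Z _; exact convex_convexHull _ _
    · intro I hI hIc
      have hfr : Module.finrank ℝ (Eu d) = d := by simp [Eu]
      rw [hfr] at hIc
      have hbad : (X.filter (fun x => ∃ Z ∈ I, x ∉ Z)).card < X.card := by
        have h1 : X.filter (fun x => ∃ Z ∈ I, x ∉ Z) ⊆ I.biUnion (fun Z => X \ Z) := by
          intro x hx
          simp only [Finset.mem_filter, Finset.mem_biUnion, Finset.mem_sdiff] at hx ⊢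
          obtain ⟨hx, Z, hZ, hxZ⟩ := hx
          exact ⟨Z, hZ, hx, hxZ⟩
        have h2 : (d + 1) * (I.biUnion (fun Z => X \ Z)).card ≤ ∑ Z ∈ I, (d + 1) * (X \ Z).card := by
          rw [← Finset.mul_sum]
          exact Nat.mul_le_mul_left _ Finset.card_biUnion_le
        have h3 : ∀ Z ∈ I, (d + 1) * (X \ Z).card + 1 ≤ X.card := by
          intro Z hZ
          have := hI hZ
          simp only [hF, Finset.mem_filter, Finset.mem_powerset] at this
          have h4 := Finset.card_sdiff_add_card_eq_card this.1
          nlinarith [this.2]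
        have h5 : ∑ Z ∈ I, (d + 1) * (X \ Z).card + I.card ≤ I.card * X.card := by
          have := Finset.sum_le_sum h3
          rw [Finset.sum_add_distrib] at this
          simpa using this
        have h6 := Finset.card_le_card h1
        have hp := hX.card_pos
        rcases Nat.eq_zero_or_pos I.card with h0 | h0
        · rw [Finset.card_eq_zero] at h0
          subst h0
          simpa using hp
        · have : I.card * X.card ≤ (d + 1) * X.card := Nat.mul_le_mul_right _ hIc
          have h7 : (d + 1) * (X.filter (fun x => ∃ Z ∈ I, x ∉ Z)).card < (d + 1) * X.card := by
            have := Nat.mul_le_mul_left (d + 1) h6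
            omega
          exact Nat.lt_of_mul_lt_mul_left h7
      obtain ⟨x, hx, hx2⟩ := Finset.exists_mem_notMem_of_card_lt_card hbad
      simp only [Finset.mem_filter, not_and, not_exists, not_not] at hx2
      refine ⟨u x, ?_⟩
      simp only [Set.mem_iInter]
      intro Z hZ
      exact subset_convexHull _ _ ⟨x, by simpa using hx2 hx Z hZ, rfl⟩
  obtain ⟨o, ho⟩ := key
  simp only [Set.mem_iInter] at ho
  refine ⟨o, fun w => ?_⟩
  by_contra hcon
  push Not at hcon
  have hsum := Finset.card_filter_add_card_filter_not (s := X) (fun x => inner ℝ o w ≤ inner ℝ (u x) w)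
  set Z := X.filter (fun x => ¬ inner ℝ o w ≤ inner ℝ (u x) w) with hZ
  have hZF : Z ∈ F := by
    simp only [hF, Finset.mem_filter, Finset.mem_powerset]
    refine ⟨Finset.filter_subset _ _, ?_⟩
    nlinarith
  have h1 := ho Z hZF
  have hconv : Convex ℝ {x : Eu d | inner ℝ x w < inner ℝ o w} := by
    apply convex_halfSpace_lt
    exact ⟨fun a b => inner_add_left _ _ _, fun a b => by simp [inner_smul_left]⟩
  have h2 : convexHull ℝ (u '' (Z : Set κ)) ⊆ {x : Eu d | inner ℝ x w < inner ℝ o w} := by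
    apply convexHull_min _ hconv
    rintro _ ⟨x, hx, rfl⟩
    simp only [hZ, Finset.coe_filter, Set.mem_ofPred_eq, not_le] at hx
    exact hx.2
  have h3 : inner ℝ o w < inner ℝ o w := h2 h1
  exact lt_irrefl _ h3

/-- a common nonzero vector orthogonal to all but two -/
theorem exists_orth (d : ℕ) (hd : 1 ≤ d) (o : Fin (d + 1) → Eu d) (a b : Fin (d + 1)) (hab : a ≠ b) :
    ∃ w : Eu d, w ≠ 0 ∧ ∀ k, k ≠ a → k ≠ b → inner ℝ (o k) w = 0 := by
  classical
  set T : Finset (Fin (d + 1)) := (Finset.univ.erase a).erase b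
  have hT : T.card = d - 1 := by
    rw [Finset.card_erase_of_mem (by simp [hab.symm]), Finset.card_erase_of_mem (by simp)]
    simp
  set V := Submodule.span ℝ ((T.image o : Finset (Eu d)) : Set (Eu d)) with hV
  have h1 : Module.finrank ℝ V ≤ d - 1 := by
    refine (finrank_span_finset_le_card _).trans (Finset.card_image_le.trans hT.le)
  have h2 := Submodule.finrank_add_finrank_orthogonal V
  have hfr : Module.finrank ℝ (Eu d) = d := by simp [Eu]
  rw [hfr] at h2
  have h3 : 0 < Module.finrank ℝ Vᗮ := by omega
  have : Vᗮ ≠ ⊥ := by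
    intro h; rw [h] at h3; simp at h3
  obtain ⟨w, hw, hw0⟩ := Submodule.exists_mem_ne_zero_of_ne_bot this
  refine ⟨w, hw0, fun k hka hkb => ?_⟩
  rw [Submodule.mem_orthogonal] at hw
  apply hw
  apply Submodule.subset_span
  simp only [Finset.coe_image, Set.mem_image]
  exact ⟨k, by simp [T, hka, hkb], rfl⟩

/-- Nonnegative dependency. -/
def PosDep {d : ℕ} (u : Fin (d + 1) → Eu d) : Prop :=
  ∃ l : Fin (d + 1) → ℝ, (∀ k, 0 ≤ l k) ∧ (∃ k, l k ≠ 0) ∧ ∑ k, l k • u k = 0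

theorem not_posDep_of_pos {d : ℕ} (u : Fin (d + 1) → Eu d) (w : Eu d)
    (h : ∀ k, 0 < inner ℝ (u k) w) : ¬ PosDep u := by
  rintro ⟨l, hl, ⟨k, hk⟩, hs⟩
  have h1 : inner ℝ (∑ k, l k • u k) w = (0:ℝ) := by rw [hs]; simp
  rw [sum_inner] at h1
  have h2 : 0 < ∑ k, inner ℝ (l k • u k) w := by
    apply Finset.sum_pos'
    · intro i _
      rw [inner_smul_left]; exact mul_nonneg (hl i) (h i).le
    · refine ⟨k, Finset.mem_univ _, ?_⟩
      rw [inner_smul_left]; exact mul_pos (lt_of_le_of_ne (hl k) (Ne.symm hk)) (h k)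
  linarith

theorem posDep_of_signs {d : ℕ} (u : Fin (d + 1) → Eu d)
    (h : ∀ S : Finset (Fin (d + 1)), S.Nonempty → S ≠ Finset.univ →
      ∃ w : Eu d, ∀ k, (k ∈ S → 0 < inner ℝ (u k) w) ∧ (k ∉ S → inner ℝ (u k) w < 0)) : PosDep u := by
  classical
  have hdep : ¬ LinearIndependent ℝ u := by
    intro hli
    have := hli.fintype_card_le_finrank
    simp [Eu] at this
  rw [Fintype.linearIndependent_iff] at hdep
  push Not at hdep
  obtain ⟨g, hg, i, hi⟩ := hdep
  set S : Finset (Fin (d + 1)) := Finset.univ.filter (fun k => 0 < g k) with hS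
  by_cases h1 : S.Nonempty
  · by_cases h2 : S = Finset.univ
    · refine ⟨g, fun k => ?_, ⟨i, hi⟩, hg⟩
      have : k ∈ S := by rw [h2]; simp
      simp [hS] at this; exact this.le
    · exfalso
      obtain ⟨w, hw⟩ := h S h1 h2
      have h3 : inner ℝ (∑ k, g k • u k) w = (0:ℝ) := by rw [hg]; simp
      rw [sum_inner] at h3
      have h4 : 0 < ∑ k, inner ℝ (g k • u k) w := by
        apply Finset.sum_pos'
        · intro k _
          rw [inner_smul_left]
          by_cases hk : k ∈ S
          · have : 0 < g k := by simpa [hS] using hk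
            exact (mul_pos this ((hw k).1 hk)).le
          · have : g k ≤ 0 := by simpa [hS] using hk
            exact mul_nonneg_of_nonpos_of_nonpos this ((hw k).2 hk).le
        · obtain ⟨k, hk⟩ := h1
          refine ⟨k, Finset.mem_univ _, ?_⟩
          rw [inner_smul_left]
          have : 0 < g k := by simpa [hS] using hk
          exact mul_pos this ((hw k).1 hk)
      linarith
  · refine ⟨fun k => - g k, fun k => ?_, ⟨i, by simpa using hi⟩, by simp [hg]⟩
    rw [Finset.not_nonempty_iff_eq_empty] at h1
    have : k ∉ S := by rw [h1]; simp
    simp only [hS, Finset.mem_filter, Finset.mem_univ, true_and, not_lt] at this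
    linarith

theorem homog_aux (d : ℕ) (hd : 1 ≤ d) {κ : Type*} (u : Fin (d + 1) → κ → Eu d) (m0 : ℕ)
    (X₀ : Fin (d + 1) → Finset κ)
    (hm : ∀ k, ∀ w : Eu d, w ≠ 0 → ((X₀ k).filter (fun x => inner ℝ (u k x) w = 0)).card ≤ m0)
    (Sg : Finset (Finset (Fin (d + 1)))) :
    ∀ L : ℕ, m0 + 1 ≤ L → ∀ X : Fin (d + 1) → Finset κ, (∀ k, X k ⊆ X₀ k) →
      (∀ k, (2 * (d + 1)) ^ Sg.card * L ≤ (X k).card) →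
      ∃ Y : Fin (d + 1) → Finset κ, (∀ k, Y k ⊆ X k) ∧ (∀ k, L ≤ (Y k).card) ∧
       ((∃ w, ∀ k, ∀ y ∈ Y k, 0 < inner ℝ (u k y) w) ∨
        ∀ S ∈ Sg, S.Nonempty → S ≠ Finset.univ → ∃ w : Eu d, ∀ k, ∀ y ∈ Y k,
          (k ∈ S → 0 < inner ℝ (u k y) w) ∧ (k ∉ S → inner ℝ (u k y) w < 0)) := by
  classical
  induction Sg using Finset.induction_on with
  | empty =>
    intro L hL X hX hc
    exact ⟨X, fun k => subset_rfl, by simpa using hc, Or.inr (by simp)⟩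
  | insert S Sg hS ih =>
    intro L hL X hX hc
    rw [Finset.card_insert_of_notMem hS] at hc
    obtain ⟨Y, hYX, hYc, hY⟩ := ih (2 * (d + 1) * L) (by nlinarith) X hX (by
      intro k; have := hc k; rw [pow_succ, mul_assoc] at this; exact this)
    have hYL : ∀ k, L ≤ (Y k).card := fun k => le_trans (by nlinarith) (hYc k)
    rcases hY with hY | hY
    · exact ⟨Y, hYX, hYL, Or.inl hY⟩
    by_cases hSn : S.Nonempty ∧ S ≠ Finset.univ
    swap
    · refine ⟨Y, hYX, hYL, Or.inr ?_⟩
      intro T hT h1 h2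
      rcases Finset.mem_insert.1 hT with rfl | hT
      · exact absurd ⟨h1, h2⟩ hSn
      · exact hY T hT h1 h2
    have hYne : ∀ k, (Y k).Nonempty := fun k => Finset.card_pos.1 (by have := hYL k; omega)
    choose o ho using fun k => centerpoint d (u k) (Y k) (hYne k)
    -- the shrinking step
    have step : ∀ k, ∀ w : Eu d, w ≠ 0 → 0 ≤ inner ℝ (o k) w →
        L ≤ ((Y k).filter (fun x => 0 < inner ℝ (u k x) w)).card := by
      intro k w hw how
      have h1 := ho k w
      have h2 := hm k w hw
      have h3 : (Y k).filter (fun x => inner ℝ (o k) w ≤ inner ℝ (u k x) w) ⊆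
          (Y k).filter (fun x => 0 < inner ℝ (u k x) w) ∪
          (X₀ k).filter (fun x => inner ℝ (u k x) w = 0) := by
        intro x hx
        simp only [Finset.mem_filter, Finset.mem_union] at hx ⊢
        rcases (how.trans hx.2).lt_or_eq with h | h
        · exact Or.inl ⟨hx.1, h⟩
        · exact Or.inr ⟨hX k (hYX k hx.1), h.symm⟩
      have h4 := (Finset.card_le_card h3).trans (Finset.card_union_le _ _)
      have h5 := hYc k
      have h6 : (d + 1) * (2 * L) ≤
          (d + 1) * ((Y k).filter (fun x => inner ℝ (o k) w ≤ inner ℝ (u k x) w)).card := by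
        calc _ = 2 * (d + 1) * L := by ring
          _ ≤ _ := h5.trans h1
      have h7 := Nat.le_of_mul_le_mul_left h6 (Nat.succ_pos d)
      omega
    have first : (∃ w : Eu d, w ≠ 0 ∧ ∀ k, 0 ≤ inner ℝ (o k) w) →
        ∃ Y' : Fin (d + 1) → Finset κ, (∀ k, Y' k ⊆ X k) ∧ (∀ k, L ≤ (Y' k).card) ∧
          (∃ w, ∀ k, ∀ y ∈ Y' k, 0 < inner ℝ (u k y) w) := by
      rintro ⟨w, hw, how⟩
      refine ⟨fun k => (Y k).filter (fun x => 0 < inner ℝ (u k x) w), fun k =>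
        (Finset.filter_subset _ _).trans (hYX k), fun k => step k w hw (how k), w, ?_⟩
      intro k y hy
      exact (Finset.mem_filter.1 hy).2
    by_cases hf : ∃ w : Eu d, w ≠ 0 ∧ ∀ k, 0 ≤ inner ℝ (o k) w
    · obtain ⟨Y', h1, h2, h3⟩ := first hf
      exact ⟨Y', h1, h2, Or.inl h3⟩
    obtain ⟨b, hb⟩ := hSn.1
    obtain ⟨a, ha⟩ : ∃ a, a ∉ S := by
      by_contra h
      push Not at h
      exact hSn.2 (Finset.eq_univ_of_forall h)
    have hab : a ≠ b := fun h => ha (h ▸ hb)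
    have hw : ∃ w : Eu d, w ≠ 0 ∧ (∀ k, k ≠ a → k ≠ b → inner ℝ (o k) w = 0) ∧
        inner ℝ (o a) w ≤ 0 ∧ 0 ≤ inner ℝ (o b) w := by
      obtain ⟨w, hw, hwo⟩ := exists_orth d hd o a b hab
      push Not at hf
      by_cases h1 : inner ℝ (o a) w ≤ 0
      · by_cases h2 : 0 ≤ inner ℝ (o b) w
        · exact ⟨w, hw, hwo, h1, h2⟩
        · exfalso
          obtain ⟨k, hk⟩ := hf (-w) (neg_ne_zero.2 hw)
          rw [inner_neg_right] at hk
          by_cases hka : k = a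
          · subst hka; linarith
          · by_cases hkb : k = b
            · subst hkb; linarith
            · rw [hwo k hka hkb] at hk; linarith
      · by_cases h2 : 0 ≤ inner ℝ (o b) w
        · exfalso
          obtain ⟨k, hk⟩ := hf w hw
          by_cases hka : k = a
          · subst hka; linarith
          · by_cases hkb : k = b
            · subst hkb; linarith
            · rw [hwo k hka hkb] at hk; linarith
        · refine ⟨-w, neg_ne_zero.2 hw, ?_, ?_, ?_⟩
          · intro k h3 h4; rw [inner_neg_right, hwo k h3 h4, neg_zero]
          · rw [inner_neg_right]; linarith
          · rw [inner_neg_right]; linarith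
    obtain ⟨w, hw, hwo, hwa, hwb⟩ := hw
    refine ⟨fun k => if k ∈ S then (Y k).filter (fun x => 0 < inner ℝ (u k x) w) else
      (Y k).filter (fun x => 0 < inner ℝ (u k x) (-w)), fun k => ?_, fun k => ?_, Or.inr ?_⟩
    · dsimp only
      split_ifs
      · exact (Finset.filter_subset _ _).trans (hYX k)
      · exact (Finset.filter_subset _ _).trans (hYX k)
    · dsimp only
      split_ifs with hk
      · apply step k w hw
        by_cases hkb : k = b
        · subst hkb; exact hwb
        · rw [hwo k (fun h => ha (h ▸ hk)) hkb]
      · apply step k (-w) (neg_ne_zero.2 hw)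
        rw [inner_neg_right]
        by_cases hka : k = a
        · subst hka; linarith
        · rw [hwo k hka (fun h => hk (h ▸ hb))]; simp
    · intro T hT h1 h2
      rcases Finset.mem_insert.1 hT with rfl | hT
      · refine ⟨w, fun k y hy => ⟨fun hk => ?_, fun hk => ?_⟩⟩
        · simp only [if_pos hk] at hy
          exact (Finset.mem_filter.1 hy).2
        · simp only [if_neg hk] at hy
          have := (Finset.mem_filter.1 hy).2
          rw [inner_neg_right] at this
          linarith
      · obtain ⟨w', hw'⟩ := hY T hT h1 h2
        refine ⟨w', fun k y hy => hw' k y ?_⟩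
        dsimp only at hy
        split_ifs at hy
        · exact (Finset.mem_filter.1 hy).1
        · exact (Finset.mem_filter.1 hy).1

theorem homog (d : ℕ) (hd : 1 ≤ d) : ∃ Q : ℕ, 1 ≤ Q ∧ ∀ {κ : Type} (u : Fin (d + 1) → κ → Eu d) (m0 : ℕ)
    (X : Fin (d + 1) → Finset κ)
    (_ : ∀ k, ∀ w : Eu d, w ≠ 0 → Set.encard {x | x ∈ X k ∧ inner ℝ (u k x) w = 0} ≤ m0)
    (L : ℕ), m0 + 1 ≤ L → (∀ k, Q * L ≤ (X k).card) →
      ∃ Y : Fin (d + 1) → Finset κ, (∀ k, Y k ⊆ X k) ∧ (∀ k, L ≤ (Y k).card) ∧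
       ((∀ y : Fin (d + 1) → κ, (∀ k, y k ∈ Y k) → PosDep (fun k => u k (y k))) ∨
        (∀ y : Fin (d + 1) → κ, (∀ k, y k ∈ Y k) → ¬ PosDep (fun k => u k (y k)))) := by
  classical
  refine ⟨(2 * (d + 1)) ^ (Finset.univ : Finset (Finset (Fin (d + 1)))).card, Nat.one_le_pow _ _ (by omega), ?_⟩
  intro κ u m0 X hm L hL hX
  obtain ⟨Y, h1, h2, h3⟩ := homog_aux d hd u m0 X (by
    intro k w hw
    have := hm k w hw
    have e : {x | x ∈ X k ∧ inner ℝ (u k x) w = 0} =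
      (((X k).filter (fun x => inner ℝ (u k x) w = 0) : Finset κ) : Set κ) := by
        ext; simp
    rw [e, Set.encard_coe_eq_coe_finsetCard] at this
    exact_mod_cast this) Finset.univ L hL X (fun k => subset_rfl) hX
  refine ⟨Y, h1, h2, ?_⟩
  rcases h3 with ⟨w, hw⟩ | h3
  · right
    intro y hy
    exact not_posDep_of_pos _ w (fun k => hw k _ (hy k))
  · left
    intro y hy
    apply posDep_of_signs
    intro S hS1 hS2
    obtain ⟨w, hw⟩ := h3 S (Finset.mem_univ _) hS1 hS2
    exact ⟨w, fun k => hw k _ (hy k)⟩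


theorem min_inner {d : ℕ} {K : Set (Eu d)} (hK : Convex ℝ K) {z p : Eu d} (hz : z ∈ K)
    (hmin : ∀ y ∈ K, ‖p - z‖ ≤ ‖p - y‖) : ∀ y ∈ K, inner ℝ (p - z) (y - z) ≤ 0 := by
  rw [← norm_eq_iInf_iff_real_inner_le_zero hK hz]
  have : Nonempty K := ⟨⟨z, hz⟩⟩
  apply le_antisymm
  · exact le_ciInf (fun w => hmin w w.2)
  · exact ciInf_le ⟨0, by rintro _ ⟨w, rfl⟩; exact norm_nonneg _⟩ (⟨z, hz⟩ : K)

theorem min_inner0 {d : ℕ} {K : Set (Eu d)} (hK : Convex ℝ K) {z : Eu d} (hz : z ∈ K)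
    (hmin : ∀ y ∈ K, ‖z‖ ≤ ‖y‖) : ∀ y ∈ K, ‖z‖ ^ 2 ≤ inner ℝ y z := by
  intro y hy
  have := min_inner hK (p := 0) hz (by simpa using hmin) y hy
  rw [zero_sub, inner_neg_left, inner_sub_right, real_inner_self_eq_norm_sq, real_inner_comm] at this
  linarith

theorem exists_min_hull {d : ℕ} {S : Set (Eu d)} (hS : S.Finite) (hne : S.Nonempty) :
    ∃ z ∈ convexHull ℝ S, ∀ y ∈ convexHull ℝ S, ‖z‖ ≤ ‖y‖ := by
  have hc : IsCompact (convexHull ℝ S) := hS.isCompact_convexHull ℝ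
  obtain ⟨z, hz, hm⟩ := hc.exists_isMinOn (hne.convexHull) (f := fun y : Eu d => ‖y‖) continuous_norm.continuousOn
  exact ⟨z, hz, fun y hy => hm hy⟩

theorem exists_nonpos_of_hull {d : ℕ} {S : Set (Eu d)} (h0 : (0 : Eu d) ∈ convexHull ℝ S) (w : Eu d) :
    ∃ y ∈ S, inner ℝ y w ≤ 0 := by
  by_contra hcon
  push Not at hcon
  have hconv : Convex ℝ {x : Eu d | 0 < inner ℝ x w} := by
    apply convex_halfSpace_gt
    exact ⟨fun a b => inner_add_left _ _ _, fun a b => by simp [inner_smul_left]⟩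
  have h2 : convexHull ℝ S ⊆ {x : Eu d | 0 < inner ℝ x w} := convexHull_min hcon hconv
  have h3 : (0:ℝ) < inner ℝ (0 : Eu d) w := h2 h0
  simp at h3

theorem hull_zero_of_nonpos {d : ℕ} {S : Set (Eu d)} (hS : S.Finite)
    (h : ∀ w, ∃ y ∈ S, inner ℝ y w ≤ 0) : (0 : Eu d) ∈ convexHull ℝ S := by
  obtain ⟨y, hy, _⟩ := h 0
  obtain ⟨z, hz, hm⟩ := exists_min_hull hS ⟨y, hy⟩
  by_cases hz0 : z = 0
  · rwa [hz0] at hz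
  exfalso
  obtain ⟨y, hy, hyz⟩ := h z
  have := min_inner0 (convex_convexHull ℝ S) hz hm y (subset_convexHull ℝ S hy)
  have hp := norm_pos_iff.2 hz0
  nlinarith

theorem posDep_of_hull {d : ℕ} (u : Fin (d + 1) → Eu d)
    (h : (0 : Eu d) ∈ convexHull ℝ (Set.range u)) : PosDep u := by
  rw [convexHull_range_eq_exists_affineCombination] at h
  obtain ⟨s, w, hw, hw1, hs⟩ := h
  rw [s.affineCombination_eq_linear_combination _ _ hw1] at hs
  refine ⟨fun k => if k ∈ s then w k else 0, ?_, ?_, ?_⟩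
  · intro k; dsimp only; split_ifs with hk
    · exact hw k hk
    · exact le_rfl
  · by_contra hcon
    push Not at hcon
    have : s.sum w = 0 := by
      apply Finset.sum_eq_zero
      intro k hk
      have := hcon k
      rwa [if_pos hk] at this
    linarith
  · simp only [ite_smul, zero_smul]
    rw [Finset.sum_ite_mem, Finset.univ_inter]
    exact hs

theorem colorful {d : ℕ} (x : Fin (d + 1) → Fin (d + 1) → Eu d)
    (h : ∀ k, (0 : Eu d) ∈ convexHull ℝ (Set.range (x k))) :
    ∃ φ : Fin (d + 1) → Fin (d + 1), PosDep (fun k => x k (φ k)) := by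
  classical
  have hm : ∀ φ : Fin (d + 1) → Fin (d + 1), ∃ z ∈ convexHull ℝ (Set.range fun k => x k (φ k)),
      ∀ y ∈ convexHull ℝ (Set.range fun k => x k (φ k)), ‖z‖ ≤ ‖y‖ := fun φ =>
    exists_min_hull (Set.finite_range _) (Set.range_nonempty _)
  choose z hz hzm using hm
  obtain ⟨φ, hφ⟩ := Finite.exists_min (fun φ => ‖z φ‖)
  by_cases hz0 : z φ = 0
  · refine ⟨φ, posDep_of_hull _ ?_⟩
    have := hz φ
    rwa [hz0] at this
  exfalso
  have hin := min_inner0 (convex_convexHull ℝ _) (hz φ) (hzm φ)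
  obtain ⟨ι, hι, p, c, hp, haff, hc, hc1, hsum⟩ := eq_pos_convex_span_of_mem_convexHull (hz φ)
  have hge : ∀ i, ‖z φ‖ ^ 2 ≤ inner ℝ (p i) (z φ) := fun i =>
    hin _ (subset_convexHull ℝ _ (hp ⟨i, rfl⟩))
  have heq : ∀ i, inner ℝ (p i) (z φ) = ‖z φ‖ ^ 2 := by
    have h1 : ∑ i, c i * (inner ℝ (p i) (z φ) - ‖z φ‖ ^ 2) = 0 := by
      have h2 : inner ℝ (∑ i, c i • p i) (z φ) = ‖z φ‖ ^ 2 := by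
        rw [hsum, real_inner_self_eq_norm_sq]
      rw [sum_inner] at h2
      simp only [inner_smul_left, RCLike.conj_to_real] at h2
      simp only [mul_sub, Finset.sum_sub_distrib, ← Finset.sum_mul, hc1, h2]
      ring
    rw [Finset.sum_eq_zero_iff_of_nonneg (fun i _ => mul_nonneg (hc i).le (sub_nonneg.2 (hge i)))] at h1
    intro i
    have := h1 i (Finset.mem_univ _)
    rcases mul_eq_zero.1 this with h3 | h3
    · exact absurd h3 (hc i).ne'
    · linarith
  have hp0 := norm_pos_iff.2 hz0
  have hli : LinearIndependent ℝ p := by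
    rw [Fintype.linearIndependent_iff]
    intro g hg i
    have h1 : inner ℝ (∑ i, g i • p i) (z φ) = (0:ℝ) := by rw [hg]; simp
    rw [sum_inner] at h1
    simp only [inner_smul_left, RCLike.conj_to_real, heq, ← Finset.sum_mul] at h1
    have h2 : ∑ i, g i = 0 := by
      rcases mul_eq_zero.1 h1 with h3 | h3
      · exact h3
      · exact absurd h3 (by positivity)
    exact affineIndependent_iff.1 haff Finset.univ g h2 hg i (Finset.mem_univ _)
  have hcard : Fintype.card ι ≤ d := by
    have := hli.fintype_card_le_finrank
    simpa [Eu] using this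
  choose col hcol using fun i => hp ⟨i, rfl⟩
  have hns : ∃ k, ∀ i, col i ≠ k := by
    by_contra hcon
    push Not at hcon
    have := Fintype.card_le_of_surjective col hcon
    simp at this
    omega
  obtain ⟨k, hk⟩ := hns
  obtain ⟨_, ⟨j, rfl⟩, hj⟩ := exists_nonpos_of_hull (h k) (z φ)
  set φ' := Function.update φ k j with hφ'
  have hzK : z φ ∈ convexHull ℝ (Set.range fun k => x k (φ' k)) := by
    rw [← hsum]
    apply (convex_convexHull ℝ _).sum_mem (fun i _ => (hc i).le) hc1
    intro i _
    apply subset_convexHull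
    refine ⟨col i, ?_⟩
    simp only [hφ', Function.update_of_ne (hk i)]
    exact hcol i
  have hyK : x k j ∈ convexHull ℝ (Set.range fun k => x k (φ' k)) := by
    apply subset_convexHull
    exact ⟨k, by simp [hφ']⟩
  have := min_inner0 (convex_convexHull ℝ _) hzK (fun y hy => (hφ φ').trans (hzm φ' y hy)) _ hyK
  nlinarith

theorem disjoint_simplices {d : ℕ} {κ : Type} [Fintype κ] (u : κ → Eu d) (t : ℕ)
    (h : ∀ w, (d + 1) * t ≤ Set.ncard {a | inner ℝ (u a) w ≤ 0}) :
    ∀ s ≤ t, ∃ x : Fin s → Fin (d + 1) → κ,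
      (∀ j j' l l', x j l = x j' l' → j = j') ∧
      ∀ j, (0 : Eu d) ∈ convexHull ℝ (Set.range (fun l => u (x j l))) := by
  classical
  intro s
  induction s with
  | zero => intro _; exact ⟨fun j => j.elim0, fun j => j.elim0, fun j => j.elim0⟩
  | succ s ih =>
    intro hs
    obtain ⟨x, hx1, hx2⟩ := ih (by omega)
    set U : Finset κ := Finset.univ.image (fun q : Fin s × Fin (d + 1) => x q.1 q.2) with hU
    have hUc : U.card ≤ s * (d + 1) := by
      refine Finset.card_image_le.trans ?_
      simp
    have hT : ∀ w, ∃ y ∈ u '' {a | a ∉ U}, inner ℝ y w ≤ 0 := by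
      intro w
      by_contra hcon
      push Not at hcon
      have hsub : {a | inner ℝ (u a) w ≤ 0} ⊆ (U : Set κ) := by
        intro a ha
        by_contra hau
        have := hcon _ ⟨a, by simpa using hau, rfl⟩
        have ha' : inner ℝ (u a) w ≤ 0 := ha
        linarith
      have h1 := Set.ncard_le_ncard hsub (Finset.finite_toSet _)
      rw [Set.ncard_coe_finset] at h1
      have := h w
      nlinarith
    have h0 := hull_zero_of_nonpos (Set.toFinite _) hT
    obtain ⟨ι, hι, p, c, hp, haff, hc, hc1, hsum⟩ := eq_pos_convex_span_of_mem_convexHull h0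
    have hcard : Fintype.card ι ≤ d + 1 := by
      have h1 := haff.card_le_finrank_succ
      have h2 := Submodule.finrank_le (vectorSpan ℝ (Set.range p))
      simp only [finrank_euclideanSpace, Fintype.card_fin] at h2
      omega
    have : Nonempty ι := by
      by_contra hne
      rw [not_nonempty_iff] at hne
      simp at hc1
    obtain ⟨e⟩ : Nonempty (ι ↪ Fin (d + 1)) :=
      Function.Embedding.nonempty_of_card_le (by simpa using hcard)
    choose a ha hau using fun i => hp ⟨i, rfl⟩
    set y : Fin (d + 1) → κ := fun l => a (Function.invFun e l) with hy
    have hyU : ∀ l j l', x j l' ≠ y l := by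
      intro l j l' heq
      have h1 : a (Function.invFun e l) ∉ U := ha _
      apply h1
      rw [hU, Finset.mem_image]
      exact ⟨(j, l'), Finset.mem_univ _, heq⟩
    refine ⟨Fin.snoc (α := fun _ => Fin (d + 1) → κ) x y, ?_, ?_⟩
    · intro j j' l l'
      refine Fin.lastCases ?_ (fun j => ?_) j
      · refine Fin.lastCases ?_ (fun j' => ?_) j'
        · intro _; rfl
        · simp only [Fin.snoc_last, Fin.snoc_castSucc]
          intro heq; exact absurd heq.symm (hyU _ _ _)
      · refine Fin.lastCases ?_ (fun j' => ?_) j'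
        · simp only [Fin.snoc_last, Fin.snoc_castSucc]
          intro heq; exact absurd heq (hyU _ _ _)
        · simp only [Fin.snoc_castSucc]
          intro heq; rw [hx1 _ _ _ _ heq]
    · intro j
      refine Fin.lastCases ?_ (fun j => ?_) j
      · simp only [Fin.snoc_last]
        rw [← hsum]
        apply (convex_convexHull ℝ _).sum_mem (fun i _ => (hc i).le) hc1
        intro i _
        apply subset_convexHull
        refine ⟨e i, ?_⟩
        simp only [hy, Function.leftInverse_invFun e.injective i]
        exact hau i
      · simp only [Fin.snoc_castSucc]
        exact hx2 j

theorem homog_all (d : ℕ) (hd : 1 ≤ d) : ∃ Q : ℕ, 1 ≤ Q ∧ ∀ {κ : Type} (m0 t : ℕ) (u : κ → Eu d)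
    (x : Fin t → Fin (d + 1) → κ) (_ : ∀ w : Eu d, w ≠ 0 → ∀ l,
      Set.encard {j | inner ℝ (u (x j l)) w = 0} ≤ m0)
    (Φ : Finset (Fin (d + 1) → Fin (d + 1))) (L : ℕ), m0 + 1 ≤ L → Q ^ Φ.card * L ≤ t →
    ∃ Z : Fin (d + 1) → Finset (Fin t), (∀ k, L ≤ (Z k).card) ∧ ∀ φ ∈ Φ,
     ((∀ y : Fin (d + 1) → Fin t, (∀ k, y k ∈ Z k) → PosDep (fun k => u (x (y k) (φ k)))) ∨
      (∀ y : Fin (d + 1) → Fin t, (∀ k, y k ∈ Z k) → ¬ PosDep (fun k => u (x (y k) (φ k))))) := by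
  classical
  obtain ⟨Q, hQ, H⟩ := homog d hd
  refine ⟨Q, hQ, ?_⟩
  intro κ m0 t u x hm Φ
  induction Φ using Finset.induction_on with
  | empty =>
    intro L _ hL
    exact ⟨fun _ => Finset.univ, by simpa using hL, by simp⟩
  | insert φ Φ hφ ih =>
    intro L hL0 hL
    rw [Finset.card_insert_of_notMem hφ, pow_succ, mul_assoc] at hL
    obtain ⟨Z, hZc, hZ⟩ := ih (Q * L) (by nlinarith) hL
    obtain ⟨Y, hYZ, hYc, hY⟩ := H (fun k j => u (x j (φ k))) m0 Z (by
      intro k w hw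
      exact (Set.encard_le_encard (by intro j hj; exact hj.2)).trans (hm w hw (φ k))) L hL0 hZc
    refine ⟨Y, hYc, ?_⟩
    intro ψ hψ
    rcases Finset.mem_insert.1 hψ with rfl | hψ
    · exact hY
    · rcases hZ ψ hψ with h | h
      · left; intro y hy; exact h y (fun k => hYZ k (hy k))
      · right; intro y hy; exact h y (fun k => hYZ k (hy k))

theorem pos_box (d : ℕ) (hd : 1 ≤ d) : ∃ Q : ℕ, 1 ≤ Q ∧ ∀ {κ : Type} [Fintype κ] (m0 : ℕ) (u : κ → Eu d)
    (_ : ∀ w : Eu d, w ≠ 0 → Set.ncard {a | inner ℝ (u a) w = 0} ≤ m0)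
    (L : ℕ) (_ : m0 + 1 ≤ L) (_ : ∀ w, Q * L ≤ Set.ncard {a | inner ℝ (u a) w ≤ 0}),
    ∃ Y : Fin (d + 1) → Finset κ, (∀ k, L ≤ (Y k).card) ∧
      ∀ y : Fin (d + 1) → κ, (∀ k, y k ∈ Y k) → PosDep (fun k => u (y k)) := by
  classical
  obtain ⟨Q, hQ, H⟩ := homog_all d hd
  refine ⟨(d + 1) * Q ^ (Finset.univ : Finset (Fin (d + 1) → Fin (d + 1))).card,
    Nat.mul_pos (Nat.succ_pos d) (pow_pos hQ _), ?_⟩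
  intro κ _ m0 u hm L hL hdep
  obtain ⟨x, hx1, hx2⟩ := disjoint_simplices u
    (Q ^ (Finset.univ : Finset (Fin (d + 1) → Fin (d + 1))).card * L)
    (by intro w; rw [← mul_assoc]; exact hdep w) _ le_rfl
  obtain ⟨Z, hZc, hZ⟩ := H m0 _ u x (by
    intro w hw l
    have hinj : Function.Injective (fun j => x j l) := fun j j' hjj => hx1 j j' l l hjj
    rw [← hinj.encard_image]
    have h1 := hm w hw
    have h2 : ((Set.ncard {a | inner ℝ (u a) w = 0} : ℕ) : ℕ∞) = _ :=
      Set.Finite.cast_ncard_eq (Set.toFinite {a | inner ℝ (u a) w = 0})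
    have h3 : Set.encard {a | inner ℝ (u a) w = 0} ≤ m0 := by
      rw [← h2]; exact_mod_cast h1
    refine (Set.encard_le_encard ?_).trans h3
    rintro _ ⟨j, hj, rfl⟩
    exact hj) Finset.univ L hL le_rfl
  have hne : ∀ k, (Z k).Nonempty := fun k => Finset.card_pos.1 (by have := hZc k; omega)
  choose y₀ hy₀ using hne
  obtain ⟨φ, hφ⟩ := colorful (fun k l => u (x (y₀ k) l)) (fun k => hx2 _)
  rcases hZ φ (Finset.mem_univ _) with h | h
  · refine ⟨fun k => (Z k).image (fun j => x j (φ k)), fun k => ?_, ?_⟩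
    · rw [Finset.card_image_of_injective _ (fun j j' hjj => hx1 j j' _ _ hjj)]
      exact hZc k
    · intro y hy
      simp only [Finset.mem_image] at hy
      choose j hj hjy using hy
      have := h j hj
      simpa [hjy] using this
  · exact absurd hφ (h y₀ hy₀)


theorem bad_finite {d : ℕ} {A : Type} [Fintype A] (v m : A → Eu d)
    (hm : ∀ f : Fin d → A, Function.Injective f → (Matrix.of (fun r s => m (f r) s)).det ≠ 0) :
    {ε : ℝ | ∃ w : Eu d, w ≠ 0 ∧ d ≤ Set.ncard {a | inner ℝ (v a + ε • m a) w = 0}}.Finite := by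
  classical
  let P : (Fin d → A) → Polynomial ℝ := fun f =>
    Matrix.det ((Polynomial.X : Polynomial ℝ) • (Matrix.of (fun r s => m (f r) s)).map Polynomial.C +
      (Matrix.of (fun r s => v (f r) s)).map Polynomial.C)
  have hP : ∀ f : Fin d → A, Function.Injective f → P f ≠ 0 := by
    intro f hf h0
    have := Polynomial.coeff_det_X_add_C_card (Matrix.of (fun r s => m (f r) s)) (Matrix.of (fun r s => v (f r) s))
    change (P f).coeff _ = _ at this
    rw [h0, Polynomial.coeff_zero] at this
    exact hm f hf this.symm
  have hev : ∀ f ε, (P f).eval ε = (Matrix.of (fun r s => (v (f r) + ε • m (f r)) s)).det := by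
    intro f ε
    have h1 : (P f).eval ε = Polynomial.evalRingHom ε (P f) := rfl
    rw [h1]
    simp only [P]
    rw [RingHom.map_det]
    congr 1
    ext r s
    simp [Matrix.map_apply]
    ring
  apply Set.Finite.subset (s := ⋃ f ∈ {f : Fin d → A | Function.Injective f}, {ε | (P f).IsRoot ε})
  · apply Set.Finite.biUnion (Set.toFinite _)
    intro f hf
    exact Polynomial.finite_setOfPred_isRoot (hP f hf)
  · rintro ε ⟨w, hw, hd⟩
    have hc : d ≤ (Set.toFinset {a | inner ℝ (v a + ε • m a) w = 0}).card := by
      rwa [← Set.ncard_eq_toFinset_card']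
    obtain ⟨T, hT, hTc⟩ := Finset.exists_subset_card_eq hc
    let e := (T.equivFinOfCardEq hTc).symm
    simp only [Set.mem_iUnion]
    refine ⟨fun r => e r, fun r s hrs => e.injective (Subtype.ext hrs), ?_⟩
    change (P _).eval ε = 0
    rw [hev]
    by_contra hne
    have := Matrix.eq_zero_of_mulVec_eq_zero hne (v := fun s => w s) (by
      ext r
      have h1 := hT (e r).2
      rw [Set.mem_toFinset] at h1
      have h2 : inner ℝ (v (e r) + ε • m (e r)) w = 0 := h1
      rw [PiLp.inner_apply] at h2
      simp only [Matrix.mulVec, dotProduct, Matrix.of_apply, Pi.zero_apply]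
      rw [← h2]
      apply Finset.sum_congr rfl
      intro s _
      simp [mul_comm])
    apply hw
    ext s
    exact congrFun this s

theorem perturb {d : ℕ} {A : Type} [Fintype A] (v : A → Eu d) (η : ℝ) (hη : 0 < η) :
    ∃ u : A × Bool → Eu d, (∀ w, w ≠ 0 → Set.ncard {a | inner ℝ (u a) w = 0} ≤ 2 * d) ∧
      (∀ a, ‖u a - v a.1‖ ≤ η) ∧ ∀ a, u (a, true) + u (a, false) = (2 : ℝ) • v a := by
  classical
  let t : A → ℝ := fun a => ((Fintype.equivFin A a : ℕ) : ℝ)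
  have ht : Function.Injective t := by
    intro a b hab
    have : ((Fintype.equivFin A a : ℕ) : ℝ) = ((Fintype.equivFin A b : ℕ) : ℝ) := hab
    exact (Fintype.equivFin A).injective (Fin.ext (by exact_mod_cast this))
  let m : A → Eu d := fun a => WithLp.toLp 2 (fun s : Fin d => t a ^ (s : ℕ))
  have hfin := bad_finite v m (by
    intro f hf
    have : (Matrix.of (fun r s => m (f r) s)) = Matrix.vandermonde (fun r => t (f r)) := by
      ext r s
      simp [m, Matrix.vandermonde_apply]
    rw [this, Matrix.det_vandermonde_ne_zero_iff]
    exact ht.comp hf)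
  set B := {ε : ℝ | ∃ w : Eu d, w ≠ 0 ∧ d ≤ Set.ncard {a | inner ℝ (v a + ε • m a) w = 0}} with hB
  set M : ℝ := 1 + ∑ a, ‖m a‖ with hM
  have hMpos : 0 < M := by
    have : 0 ≤ ∑ a, ‖m a‖ := Finset.sum_nonneg (fun a _ => norm_nonneg _)
    linarith
  have hinf : (Set.Ioo (0:ℝ) (η / M)).Infinite := Set.Ioo_infinite (by positivity)
  have hfin2 : (B ∪ (fun ε => -ε) '' B).Finite := hfin.union (hfin.image _)
  obtain ⟨ε, hε, hεB⟩ := (hinf.sdiff hfin2).nonempty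
  have h1 : ε ∉ B := fun h => hεB (Or.inl h)
  have h2 : -ε ∉ B := fun h => hεB (Or.inr ⟨-ε, h, by simp⟩)
  refine ⟨fun a => v a.1 + (if a.2 then ε else -ε) • m a.1, ?_, ?_, ?_⟩
  · intro w hw
    dsimp only
    have h3 : Set.ncard {a | inner ℝ (v a + ε • m a) w = 0} ≤ d := by
      by_contra hcon
      exact h1 ⟨w, hw, by omega⟩
    have h4 : Set.ncard {a | inner ℝ (v a + (-ε) • m a) w = 0} ≤ d := by
      by_contra hcon
      exact h2 ⟨w, hw, by omega⟩
    have hsub : {a : A × Bool | inner ℝ (v a.1 + (if a.2 then ε else -ε) • m a.1) w = 0} ⊆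
        (fun a => (a, true)) '' {a | inner ℝ (v a + ε • m a) w = 0} ∪
        (fun a => (a, false)) '' {a | inner ℝ (v a + (-ε) • m a) w = 0} := by
      rintro ⟨a, b⟩ hab
      cases b
      · right; exact ⟨a, by simpa using hab, rfl⟩
      · left; exact ⟨a, by simpa using hab, rfl⟩
    have h5 := Set.ncard_le_ncard hsub (Set.toFinite _)
    have h6 := Set.ncard_union_le ((fun a => (a, true)) '' {a | inner ℝ (v a + ε • m a) w = 0})
        ((fun a => (a, false)) '' {a | inner ℝ (v a + (-ε) • m a) w = 0})
    have h7 := Set.ncard_image_le (f := fun a => (a, true)) (Set.toFinite {a | inner ℝ (v a + ε • m a) w = 0})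
    have h8 := Set.ncard_image_le (f := fun a => (a, false)) (Set.toFinite {a | inner ℝ (v a + (-ε) • m a) w = 0})
    omega
  · rintro ⟨a, b⟩
    have h3 : ‖m a‖ ≤ M := by
      have := Finset.single_le_sum (f := fun a => ‖m a‖) (fun a _ => norm_nonneg _) (Finset.mem_univ a)
      linarith
    have h4 : ‖(if b then ε else -ε)‖ = ε := by
      cases b <;> simp [abs_of_pos hε.1]
    simp only [add_sub_cancel_left, norm_smul, h4]
    calc ε * ‖m a‖ ≤ ε * M := by gcongr; exact hε.1.le
      _ ≤ η / M * M := by gcongr; exact hε.2.le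
      _ = η := by field_simp
  · intro a
    simp [two_smul]
    abel


theorem proj_field {d : ℕ} (K : Set (Eu d)) (hK : Convex ℝ K) (hc : IsCompact K) :
    ∃ v : Eu d → Eu d, Continuous v ∧ (∀ p, v p = 0 → K = ∅ ∨ p ∈ K) ∧
      (∀ p, ∀ x ∈ K, ‖v p‖ ^ 2 ≤ inner ℝ (x - p) (v p)) ∧
      ∀ R, 0 < R → (∀ x ∈ K, ‖x‖ < R) → ∀ p, R ≤ ‖p‖ → v p = 0 ∨ 0 < inner ℝ (v p) (-p) := by
  rcases K.eq_empty_or_nonempty with h0 | hne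
  · exact ⟨fun _ => 0, continuous_const, fun _ _ => Or.inl h0, by simp [h0], fun _ _ _ _ _ => Or.inl rfl⟩
  have hex : ∀ p : Eu d, ∃ z ∈ K, ∀ y ∈ K, ‖p - z‖ ≤ ‖p - y‖ := by
    intro p
    obtain ⟨z, hz, hm⟩ := hc.exists_isMinOn hne (f := fun y : Eu d => ‖p - y‖) (by fun_prop)
    exact ⟨z, hz, fun y hy => hm hy⟩
  choose P hPK hPm using hex
  have hin := fun p => min_inner hK (hPK p) (hPm p)
  have hlip : LipschitzWith 1 P := by
    apply LipschitzWith.of_dist_le_mul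
    intro p q
    rw [dist_eq_norm, dist_eq_norm, NNReal.coe_one, one_mul]
    have h1 := hin p _ (hPK q)
    have h2 := hin q _ (hPK p)
    have h3 : inner ℝ (p - P p) (P q - P p) + inner ℝ (q - P q) (P p - P q) =
        ‖P p - P q‖ ^ 2 - inner ℝ (p - q) (P p - P q) := by
      rw [← real_inner_self_eq_norm_sq]
      simp only [inner_sub_left, inner_sub_right]
      ring
    have h4 := real_inner_le_norm (p - q) (P p - P q)
    by_contra hcon
    push Not at hcon
    nlinarith [norm_nonneg (p - q), norm_nonneg (P p - P q)]
  refine ⟨fun p => P p - p, hlip.continuous.sub continuous_id, ?_, ?_, ?_⟩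
  · intro p hp
    right
    rw [← sub_eq_zero.1 hp]
    exact hPK p
  · intro p x hx
    have h1 := hin p x hx
    have h2 : inner ℝ (x - p) (P p - p) = ‖P p - p‖ ^ 2 - inner ℝ (p - P p) (x - P p) := by
      rw [← real_inner_self_eq_norm_sq]
      have e1 : x - p = (x - P p) + (P p - p) := by abel
      have e2 : p - P p = -(P p - p) := by abel
      rw [e1, inner_add_left, e2, inner_neg_left, real_inner_comm (P p - p) (x - P p)]
      ring
    rw [h2]
    linarith
  · intro R hR hKR p hp
    right
    have h1 := hKR _ (hPK p)
    have h2 := real_inner_le_norm (P p) p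
    rw [inner_neg_right, inner_sub_left, real_inner_self_eq_norm_sq]
    nlinarith [norm_nonneg (P p)]

open Classical in
theorem compact_case (d : ℕ) (hd : 1 ≤ d) (β : ℝ) (hβ0 : 0 ≤ β) (hβ1 : β < 1) :
    ∃ α : ℝ, 0 < α ∧ ∀ n : ℕ, 0 < n → 1 < α * n → ∀ K : Fin n → Set (Eu d),
      (∀ i, Convex ℝ (K i)) → (∀ i, IsCompact (K i)) →
      (∀ I : Fin (d + 1) → Finset (Fin n), (∀ k, α * (n : ℝ) ≤ ((I k).card : ℝ)) →
          ∃ f : Fin (d + 1) → Fin n, (∀ k, f k ∈ I k) ∧ (⋂ k, K (f k)).Nonempty) →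
      ∃ p, β * n ≤ ((Finset.univ.filter fun i => p ∈ K i).card : ℝ) := by
  obtain ⟨γ, hγ, hdeep⟩ := deep_point d ((1 + β) / 2) (by linarith) (by linarith)
  obtain ⟨Q, hQ, hbox⟩ := pos_box d hd
  have hQ' : (0:ℝ) < Q := by exact_mod_cast hQ
  refine ⟨min ((1 - β) / 2) (γ / (4 * Q * (2 * d + 1))), lt_min (by linarith) (by positivity), ?_⟩
  set α := min ((1 - β) / 2) (γ / (4 * Q * (2 * d + 1))) with hα
  intro n hn hαn K hKc hKk hyp
  have hn' : (0:ℝ) < n := by exact_mod_cast hn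
  have hα1 : α ≤ (1 - β) / 2 := min_le_left _ _
  have hα2 : α ≤ γ / (4 * Q * (2 * d + 1)) := min_le_right _ _
  have hd' : (1:ℝ) ≤ d := by exact_mod_cast hd
  have hbig : 4 * (2 * d + 1) * (α * n) ≤ γ * n / Q := by
    have : α * (4 * Q * (2 * d + 1)) ≤ γ := by rwa [le_div_iff₀ (by positivity)] at hα2
    rw [le_div_iff₀ hQ']
    nlinarith
  by_contra hcon
  push Not at hcon
  choose v hvc hv0 hvK hvR using fun i => proj_field (K i) (hKc i) (hKk i)
  obtain ⟨R, hR0, hR⟩ : ∃ R : ℝ, 0 < R ∧ ∀ i, ∀ x ∈ K i, ‖x‖ < R := by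
    have hb : Bornology.IsBounded (⋃ i, K i) := (isCompact_iUnion hKk).isBounded
    obtain ⟨R, hR0, hR⟩ := hb.exists_pos_norm_lt
    exact ⟨R, hR0, fun i x hx => hR x (Set.mem_iUnion.2 ⟨i, hx⟩)⟩
  have hE : ((Finset.univ.filter fun i => K i = ∅).card : ℝ) < α * n := by
    by_contra hE
    push Not at hE
    obtain ⟨f, hf, x, hx⟩ := hyp (fun _ => Finset.univ.filter fun i => K i = ∅) (fun _ => hE)
    have h1 := (Finset.mem_filter.1 (hf 0)).2
    have h2 := Set.mem_iInter.1 hx 0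
    rw [h1] at h2
    exact h2
  obtain ⟨p, hp⟩ := hdeep n hn v hvc R hR0 (fun i q hq => hvR i R hR0 (hR i) q hq) (by
    intro q
    have h1 : (Finset.univ.filter fun i => v i q = 0) ⊆
        (Finset.univ.filter fun i => K i = ∅) ∪ (Finset.univ.filter fun i => q ∈ K i) := by
      intro i hi
      have := hv0 i q (Finset.mem_filter.1 hi).2
      simpa [Finset.mem_union, Finset.mem_filter] using this
    have h2 : ((Finset.univ.filter fun i => v i q = 0).card : ℝ) ≤
        ((Finset.univ.filter fun i => K i = ∅).card : ℝ) + ((Finset.univ.filter fun i => q ∈ K i).card : ℝ) := by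
      exact_mod_cast (Finset.card_le_card h1).trans (Finset.card_union_le _ _)
    have h3 := hcon q
    nlinarith)
  let A := {i : Fin n // v i p ≠ 0}
  obtain ⟨η, hη0, hη⟩ : ∃ η : ℝ, 0 < η ∧ ∀ a : A, η * (R + ‖p‖) < ‖v a.1 p‖ ^ 2 := by
    have h1 : ∀ a : A, ∀ᶠ η in nhdsWithin (0:ℝ) (Set.Ioi 0), η * (R + ‖p‖) < ‖v a.1 p‖ ^ 2 := by
      intro a
      apply Filter.Eventually.filter_mono nhdsWithin_le_nhds
      have hpos : (0:ℝ) * (R + ‖p‖) < ‖v a.1 p‖ ^ 2 := by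
        have := norm_pos_iff.2 a.2
        rw [zero_mul]; positivity
      have hcont : ContinuousAt (fun η : ℝ => η * (R + ‖p‖)) 0 := by fun_prop
      exact hcont.eventually (gt_mem_nhds hpos)
    have h2 := (Filter.eventually_all.2 h1).and self_mem_nhdsWithin
    obtain ⟨η, h3, h4⟩ := h2.exists
    exact ⟨η, h4, h3⟩
  obtain ⟨u, hu1, hu2, hu3⟩ := perturb (fun a : A => v a.1 p) η hη0
  -- positivity certificate
  have hpos : ∀ a : A × Bool, ∀ x ∈ K a.1.1, 0 < inner ℝ (u a) (x - p) := by
    intro a x hx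
    have h1 := hvK a.1.1 p x hx
    have h2 := hu2 a
    have h3 : ‖x - p‖ ≤ R + ‖p‖ := (norm_sub_le _ _).trans (by linarith [hR _ x hx])
    have h4 := hη a.1
    have h5 := abs_le.1 (abs_real_inner_le_norm (u a - v a.1.1 p) (x - p))
    have h6 : inner ℝ (u a) (x - p) = inner ℝ (u a - v a.1.1 p) (x - p) + inner ℝ (x - p) (v a.1.1 p) := by
      rw [inner_sub_left, real_inner_comm (x - p) (v a.1.1 p)]; ring
    have h7 : ‖u a - v a.1.1 p‖ * ‖x - p‖ ≤ η * (R + ‖p‖) := by gcongr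
    rw [h6]
    linarith [h5.1]
  set L := ⌊γ * n / Q⌋₊ with hL
  have hLle : (L : ℝ) ≤ γ * n / Q := Nat.floor_le (by positivity)
  have hLgt : γ * n / Q < L + 1 := Nat.lt_floor_add_one _
  have hL1 : 2 * d + 1 ≤ L := by
    apply Nat.le_floor
    push_cast
    nlinarith
  have hL2 : 2 * (α * n) ≤ L := by nlinarith
  obtain ⟨Y, hYc, hY⟩ := hbox (2 * d) u hu1 L hL1 (by
    intro w
    have h1 := hp w
    have h2 : (Q * L : ℝ) ≤ γ * n := by
      rw [le_div_iff₀ hQ'] at hLle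
      linarith
    have h3 : (Finset.univ.filter fun i => v i p ≠ 0 ∧ inner ℝ (v i p) w ≤ 0).card ≤
        Set.ncard {a | inner ℝ (u a) w ≤ 0} := by
      rw [← Set.ncard_coe_finset]
      have hsub : ((Finset.univ.filter fun i => v i p ≠ 0 ∧ inner ℝ (v i p) w ≤ 0 : Finset (Fin n)) : Set (Fin n)) ⊆
          (fun a : A × Bool => a.1.1) '' {a | inner ℝ (u a) w ≤ 0} := by
        intro i hi
        have hi' := (Finset.mem_filter.1 (Finset.mem_coe.1 hi)).2
        have h4 := hu3 ⟨i, hi'.1⟩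
        have h5 : inner ℝ (u (⟨i, hi'.1⟩, true)) w + inner ℝ (u (⟨i, hi'.1⟩, false)) w = 2 * inner ℝ (v i p) w := by
          rw [← inner_add_left, h4, inner_smul_left]
          simp
        by_cases h6 : inner ℝ (u (⟨i, hi'.1⟩, true)) w ≤ 0
        · exact ⟨(⟨i, hi'.1⟩, true), h6, rfl⟩
        · refine ⟨(⟨i, hi'.1⟩, false), ?_, rfl⟩
          have : inner ℝ (u (⟨i, hi'.1⟩, false)) w ≤ 0 := by
            have := hi'.2
            linarith
          exact this
      exact (Set.ncard_le_ncard hsub (Set.toFinite _)).trans (Set.ncard_image_le (Set.toFinite _))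
    have h4 : ((Q * L : ℕ) : ℝ) ≤ (Set.ncard {a | inner ℝ (u a) w ≤ 0} : ℝ) := by
      push_cast
      have : ((Finset.univ.filter fun i => v i p ≠ 0 ∧ inner ℝ (v i p) w ≤ 0).card : ℝ) ≤
        (Set.ncard {a | inner ℝ (u a) w ≤ 0} : ℝ) := by exact_mod_cast h3
      linarith
    exact_mod_cast h4)
  obtain ⟨f, hf, x, hx⟩ := hyp (fun k => (Y k).image (fun a => a.1.1)) (by
    intro k
    have h1 : Y k ⊆ ((Y k).image (fun a => a.1)) ×ˢ Finset.univ := by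
      intro a ha
      simp only [Finset.mem_product, Finset.mem_univ, and_true]
      exact Finset.mem_image_of_mem _ ha
    have h2 := Finset.card_le_card h1
    rw [Finset.card_product] at h2
    have h3 : (Y k).image (fun a => a.1.1) = ((Y k).image (fun a => a.1)).image Subtype.val := by
      rw [Finset.image_image]; rfl
    rw [h3, Finset.card_image_of_injective _ Subtype.val_injective]
    have h4 := hYc k
    have h5 : (L : ℝ) ≤ (((Y k).image (fun a => a.1)).card : ℝ) * 2 := by
      have : L ≤ ((Y k).image (fun a => a.1)).card * 2 := by simpa using h4.trans h2
      exact_mod_cast this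
    linarith)
  simp only [Finset.mem_image] at hf
  choose y hy hyf using hf
  refine not_posDep_of_pos _ (x - p) (fun k => hpos (y k) x ?_) (hY y hy)
  rw [hyf k]
  exact Set.mem_iInter.1 hx k

/-- **Depth Helly theorem**. -/
theorem depth_helly (d : ℕ) (hd : 1 ≤ d) (β : ℝ) (hβ0 : 0 ≤ β) (hβ1 : β < 1) :
    ∃ α : ℝ, 0 < α ∧
      ∀ n : ℕ, d + 1 ≤ n →
      ∀ C : Fin n → Set (EuclideanSpace ℝ (Fin d)), (∀ i, Convex ℝ (C i)) →
        (∀ I : Fin (d + 1) → Finset (Fin n), (∀ k, α * (n : ℝ) ≤ ((I k).card : ℝ)) →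
          ∃ f : Fin (d + 1) → Fin n, (∀ k, f k ∈ I k) ∧ (⋂ k, C (f k)).Nonempty) →
        ∃ J : Finset (Fin n), β * (n : ℝ) ≤ (J.card : ℝ) ∧ (⋂ j ∈ J, C j).Nonempty := by
  classical
  obtain ⟨α, hα, H⟩ := compact_case d hd β hβ0 hβ1
  refine ⟨α, hα, fun n hn C hC hyp => ?_⟩
  have hn0 : 0 < n := by omega
  by_cases hsmall : α * n ≤ 1
  · refine ⟨Finset.univ, ?_, ?_⟩
    · rw [Finset.card_univ, Fintype.card_fin]
      have : (0:ℝ) ≤ n := by positivity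
      nlinarith
    · apply Convex.helly_theorem' (𝕜 := ℝ) (fun i _ => hC i)
      intro I _ hI
      have hfr : Module.finrank ℝ (EuclideanSpace ℝ (Fin d)) = d := by simp
      rw [hfr] at hI
      rcases I.eq_empty_or_nonempty with rfl | hne
      · simp
      obtain ⟨i0, hi0⟩ := hne
      have : Nonempty I := ⟨⟨i0, hi0⟩⟩
      obtain ⟨e⟩ : Nonempty (I ↪ Fin (d + 1)) :=
        Function.Embedding.nonempty_of_card_le (by simpa using hI)
      obtain ⟨f, hf, x, hx⟩ := hyp (fun k => {((Function.invFun e k : I) : Fin n)}) (by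
        intro k; simpa using hsmall)
      refine ⟨x, ?_⟩
      simp only [Set.mem_iInter]
      intro i hi
      have h1 := Set.mem_iInter.1 hx (e ⟨i, hi⟩)
      have h2 := Finset.mem_singleton.1 (hf (e ⟨i, hi⟩))
      rw [h2, Function.leftInverse_invFun e.injective] at h1
      exact h1
  push Not at hsmall
  have hx : ∀ f : Fin (d + 1) → Fin n, ∃ x, (⋂ k, C (f k)).Nonempty → x ∈ ⋂ k, C (f k) := by
    intro f
    by_cases h : (⋂ k, C (f k)).Nonempty
    · exact ⟨h.some, fun _ => h.some_mem⟩
    · exact ⟨0, fun h' => absurd h' h⟩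
  choose x hx using hx
  let T : Fin n → Set (EuclideanSpace ℝ (Fin d)) := fun i =>
    x '' {f | (⋂ k, C (f k)).Nonempty ∧ i ∈ Set.range f}
  have hTC : ∀ i, convexHull ℝ (T i) ⊆ C i := by
    intro i
    apply convexHull_min _ (hC i)
    rintro _ ⟨f, ⟨hf, k, rfl⟩, rfl⟩
    exact Set.mem_iInter.1 (hx f hf) k
  obtain ⟨p, hp⟩ := H n hn0 hsmall (fun i => convexHull ℝ (T i)) (fun i => convex_convexHull _ _)
    (fun i => (Set.toFinite (T i)).isCompact_convexHull ℝ) (by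
      intro I hI
      obtain ⟨f, hf, hne⟩ := hyp I hI
      refine ⟨f, hf, x f, ?_⟩
      rw [Set.mem_iInter]
      intro k
      exact subset_convexHull ℝ _ ⟨f, ⟨hne, k, rfl⟩, rfl⟩)
  refine ⟨_, hp, p, ?_⟩
  simp only [Set.mem_iInter]
  intro i hi
  exact hTC i (Finset.mem_filter.1 hi).2
end
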